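/- arXiv:1608.06804 — 12 statements merged into one kernel-verified Lean document; each statement's English description precedes it below -/
import Mathlib

section
/- For every finite simple graph G, the Grundy total domination number satisfies γ_gr^t(G) ≤ 2·τ(G), where τ(G) is the vertex cover number of G. -/
/-- `s` is a legal (open neighborhood) sequence in `G`: its entries are distinct and every
entry totally dominates (is adjacent to) some vertex not totally dominated by earlier entries. -/
def IsLegalSeq {V : Type*} (G : SimpleGraph V) (s : List V) : Prop :=
  s.Nodup ∧ ∀ i : Fin s.length, ∃ w : V, G.Adj (s.get i) w ∧
    ∀ j : Fin s.length, (j : ℕ) < (i : ℕ) → ¬ G.Adj (s.get j) w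

/-- The Grundy total domination number: the maximum length of a legal sequence. -/
noncomputable def grundyTotal {V : Type*} (G : SimpleGraph V) : ℕ :=
  sSup {n | ∃ s : List V, IsLegalSeq G s ∧ s.length = n}

/-- The vertex cover number: the minimum cardinality of a set of vertices meeting all edges. -/
noncomputable def vertexCoverNumber {V : Type*} (G : SimpleGraph V) : ℕ :=
  sInf {n | ∃ S : Set V, S.ncard = n ∧ ∀ ⦃u w : V⦄, G.Adj u w → u ∈ S ∨ w ∈ S}

/-- In a legal sequence, charge each entry to itself if it lies in the vertex cover, and otherwise
to a vertex it newly dominates; each vertex of the cover is charged at most twice. -/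
theorem IsLegalSeq.length_le_two_mul_ncard {V : Type*} {G : SimpleGraph V} {s : List V}
    (hs : IsLegalSeq G s) {S : Set V} (hfin : S.Finite)
    (hS : ∀ ⦃u w : V⦄, G.Adj u w → u ∈ S ∨ w ∈ S) : s.length ≤ 2 * S.ncard := by
  classical
  obtain ⟨hnodup, hlegal⟩ := hs
  choose f hadj hnew using hlegal
  have hf : Function.Injective f := by
    intro i j hij
    rcases lt_trichotomy (i : ℕ) (j : ℕ) with h | h | h
    · exact absurd (hij ▸ hadj i) (hnew j i h)
    · exact Fin.ext h
    · exact absurd (hij ▸ hadj j) (hnew i j h)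
  have hget : Function.Injective s.get := List.nodup_iff_injective_get.mp hnodup
  let charge : Fin s.length → S ⊕ S := fun i =>
    if h : s.get i ∈ S then Sum.inl ⟨s.get i, h⟩
    else Sum.inr ⟨f i, (hS (hadj i)).resolve_left h⟩
  have hcharge : Function.Injective charge := by
    intro i j hij
    by_cases hi : s.get i ∈ S <;> by_cases hj : s.get j ∈ S <;>
      simp only [charge, dif_pos, dif_neg, hi, hj, not_false_eq_true, Sum.inl.injEq, Sum.inr.injEq,
        Subtype.mk.injEq, reduceCtorEq] at hij
    · exact hget hij
    · exact hf hij
  have : Finite S := hfin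
  have hcard := Nat.card_le_card_of_injective charge hcharge
  rwa [Nat.card_sum, Nat.card_fin, Nat.card_coe_set_eq, ← two_mul] at hcard

theorem grundyTotal_le_two_mul_vertexCoverNumber {V : Type*} [Fintype V]
    (G : SimpleGraph V) : grundyTotal G ≤ 2 * vertexCoverNumber G := by
  obtain ⟨S, hcard, hS⟩ : vertexCoverNumber G ∈
      {n | ∃ S : Set V, S.ncard = n ∧ ∀ ⦃u w : V⦄, G.Adj u w → u ∈ S ∨ w ∈ S} :=
    Nat.sInf_mem ⟨_, Set.univ, rfl, fun _ _ _ => Or.inl (Set.mem_univ _)⟩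
  refine csSup_le ⟨0, [], ⟨List.nodup_nil, fun i => i.elim0⟩, rfl⟩ ?_
  rintro n ⟨s, hs, rfl⟩
  exact hcard ▸ hs.length_le_two_mul_ncard S.toFinite hS
end

section
/- For every finite bipartite simple graph G, the Grundy total domination number satisfies γ_gr^t(G) ≤ 2·ν(G), where ν(G) is the matching number of G. -/
/-- The matching number: the maximum number of edges in a set of pairwise disjoint edges. -/
noncomputable def matchingNumber {V : Type*} (G : SimpleGraph V) : ℕ :=
  sSup {n | ∃ M : Set (Sym2 V), M.ncard = n ∧ M ⊆ G.edgeSet ∧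
    M.Pairwise (fun e f => ∀ v : V, v ∈ e → v ∉ f)}

/-- In a finite graph, a set of pairwise disjoint edges has at most `matchingNumber G` elements. -/
theorem ncard_le_matchingNumber {V : Type*} [Finite V] {G : SimpleGraph V} {M : Set (Sym2 V)}
    (hM : M ⊆ G.edgeSet) (hdisj : M.Pairwise (fun e f => ∀ v : V, v ∈ e → v ∉ f)) :
    M.ncard ≤ matchingNumber G := by
  refine le_csSup ⟨Nat.card (Sym2 V), ?_⟩ ⟨M, rfl, hM, hdisj⟩
  rintro _ ⟨N, rfl, -, -⟩
  exact Set.ncard_le_card N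

/-- Edges `f i, g i` with `f`, `g` injective on `A` whose values never meet form a matching. -/
theorem card_le_matchingNumber_of_injOn {V ι : Type*} [Finite V] {G : SimpleGraph V}
    {f g : ι → V} {A : Finset ι} (hadj : ∀ i ∈ A, G.Adj (f i) (g i)) (hf : Set.InjOn f A)
    (hg : Set.InjOn g A) (hfg : ∀ i ∈ A, ∀ j ∈ A, f i ≠ g j) :
    A.card ≤ matchingNumber G := by
  have hinj : Set.InjOn (fun i => s(f i, g i)) (A : Set ι) := by
    intro i hi j hj hij
    rcases Sym2.eq_iff.mp hij with h | h
    · exact hf hi hj h.1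
    · exact absurd h.1 (hfg i hi j hj)
  rw [← Set.ncard_coe_finset, ← hinj.ncard_image]
  refine ncard_le_matchingNumber ?_ ?_
  · rintro _ ⟨i, hi, rfl⟩
    exact hadj i hi
  · rintro _ ⟨i, hi, rfl⟩ _ ⟨j, hj, rfl⟩ hne v hv hv'
    have hij : i ≠ j := fun h => hne (by rw [h])
    rcases Sym2.mem_iff.mp hv with h | h <;> rcases Sym2.mem_iff.mp hv' with h' | h'
    · exact hij (hf hi hj (h.symm.trans h'))
    · exact hfg i hi j hj (h.symm.trans h')
    · exact hfg j hj i hi (h'.symm.trans h)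
    · exact hij (hg hi hj (h.symm.trans h'))

/-- The vertices newly dominated along a legal sequence can be chosen pairwise distinct. -/
theorem IsLegalSeq.exists_injective_adj {V : Type*} {G : SimpleGraph V} {s : List V}
    (hs : IsLegalSeq G s) :
    ∃ w : Fin s.length → V, Function.Injective w ∧ ∀ i, G.Adj (s.get i) (w i) := by
  choose w hadj hnew using hs.2
  refine ⟨w, fun i j hij => ?_, hadj⟩
  rcases lt_trichotomy i j with h | h | h
  · exact absurd (hij ▸ hadj i) (hnew j i h)
  · exact h
  · exact absurd (hij ▸ hadj j) (hnew i j h)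

theorem grundyTotal_le_two_mul_matchingNumber_of_bipartite {V : Type*} [Fintype V]
    (G : SimpleGraph V) (hbip : G.Colorable 2) :
    grundyTotal G ≤ 2 * matchingNumber G := by
  refine csSup_le' ?_
  rintro _ ⟨s, hs, rfl⟩
  obtain ⟨C⟩ := hbip
  obtain ⟨w, hw, hadj⟩ := hs.exists_injective_adj
  have hclass : ∀ c : Fin 2,
      (Finset.univ.filter fun i => C (s.get i) = c).card ≤ matchingNumber G := by
    intro c
    refine card_le_matchingNumber_of_injOn (fun i _ => hadj i)
      (List.nodup_iff_injective_get.mp hs.1).injOn hw.injOn ?_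
    intro i hi j hj hij
    have hci : C (s.get i) = c := (Finset.mem_filter.mp hi).2
    have hcj : C (s.get j) = c := (Finset.mem_filter.mp hj).2
    exact C.valid (hadj j) (hcj.trans (hij ▸ hci.symm))
  calc s.length = (Finset.univ : Finset (Fin s.length)).card := by simp
    _ = ∑ c : Fin 2, (Finset.univ.filter fun i => C (s.get i) = c).card :=
      Finset.card_eq_sum_card_fiberwise fun _ _ => Finset.mem_coe.mpr (Finset.mem_univ _)
    _ ≤ ∑ _c : Fin 2, matchingNumber G := Finset.sum_le_sum fun c _ => hclass c
    _ = 2 * matchingNumber G := by simp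
end

section
/- For every finite simple graph G on n vertices and for each k ∈ {1,…,n}, the Grundy total domination number satisfies γ_gr^t(G) ≤ k + n − δ_k(G), where δ_k(G) = min{|N(U)| : U ⊆ V(G), |U| = k} and N(U) = ⋃_{v ∈ U} N(v). -/
/-- `deltaK G k` is the minimum of `|N(U)|` over all vertex sets `U` of cardinality `k`,
where `N(U) = ⋃_{v ∈ U} N(v)`. -/
noncomputable def deltaK {V : Type*} (G : SimpleGraph V) (k : ℕ) : ℕ :=
  sInf {m | ∃ U : Set V, U.ncard = k ∧ (⋃ v ∈ U, G.neighborSet v).ncard = m}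

/-- The minimum `deltaK G k` is at most the number of vertices. -/
theorem deltaK_le_card {V : Type*} [Fintype V] (G : SimpleGraph V) {k : ℕ}
    (hk : k ≤ Fintype.card V) : deltaK G k ≤ Fintype.card V := by
  obtain ⟨t, -, ht⟩ := Finset.exists_subset_card_eq (s := (Finset.univ : Finset V)) (n := k) hk
  have hle : deltaK G k ≤ (⋃ v ∈ (t : Set V), G.neighborSet v).ncard :=
    Nat.sInf_le ⟨(t : Set V), by simpa using ht, rfl⟩
  refine hle.trans ?_
  rw [← Nat.card_eq_fintype_card]
  exact Set.ncard_le_card _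

/-- In a legal sequence of length at least `k`, the vertices footprinted after the first `k` terms
are distinct and lie outside the neighborhood of those terms. -/
theorem IsLegalSeq.length_add_deltaK_le {V : Type*} [Fintype V] {G : SimpleGraph V} {s : List V}
    (hs : IsLegalSeq G s) {k : ℕ} (hk : k ≤ s.length) :
    s.length + deltaK G k ≤ k + Fintype.card V := by
  obtain ⟨hnd, h⟩ := hs
  choose w hw hw' using h
  let g : Fin k → V := fun i => s.get (i.castLE hk)
  have hg : Function.Injective g := fun i j hij =>
    Fin.castLE_injective hk (List.nodup_iff_injective_get.1 hnd hij)
  have hwinj : Function.Injective w := by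
    intro i j hij
    rcases lt_trichotomy i j with hlt | heq | hgt
    · exact absurd (hij ▸ hw i) (hw' j i hlt)
    · exact heq
    · exact absurd (hij ▸ hw j) (hw' i j hgt)
  let f : Fin (s.length - k) → V := fun i => w ⟨k + i, by omega⟩
  have hf : Function.Injective f := by
    intro i j hij
    have := congrArg Fin.val (hwinj hij)
    exact Fin.ext (by simpa using this)
  have hU : (Set.range g).ncard = k := by
    rw [← Set.image_univ, Set.ncard_image_of_injective _ hg]
    simp
  have hF : (Set.range f).ncard = s.length - k := by
    rw [← Set.image_univ, Set.ncard_image_of_injective _ hf]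
    simp
  have hsub : Set.range f ⊆ (⋃ v ∈ Set.range g, G.neighborSet v)ᶜ := by
    rintro _ ⟨i, rfl⟩ hmem
    simp only [Set.mem_iUnion, SimpleGraph.mem_neighborSet] at hmem
    obtain ⟨_, ⟨j, rfl⟩, hadj⟩ := hmem
    refine hw' ⟨k + i, by omega⟩ (j.castLE hk) ?_ hadj
    simp only [Fin.val_castLE]
    omega
  have hle := Set.ncard_le_ncard hsub
  have hcompl := Set.ncard_add_ncard_compl (⋃ v ∈ Set.range g, G.neighborSet v)
  have hdelta : deltaK G k ≤ (⋃ v ∈ Set.range g, G.neighborSet v).ncard :=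
    Nat.sInf_le ⟨_, hU, rfl⟩
  rw [Nat.card_eq_fintype_card] at hcompl
  omega

theorem grundyTotal_le_add_card_sub_deltaK {V : Type*} [Fintype V]
    (G : SimpleGraph V) (k : ℕ) (hk1 : 1 ≤ k) (hk2 : k ≤ Fintype.card V) :
    grundyTotal G ≤ k + Fintype.card V - deltaK G k := by
  refine csSup_le ⟨0, [], ⟨List.nodup_nil, fun i => i.elim0⟩, rfl⟩ ?_
  rintro _ ⟨s, hs, rfl⟩
  have hdelta := deltaK_le_card G hk2
  rcases le_total k s.length with hk | hk
  · have := hs.length_add_deltaK_le hk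
    omega
  · omega
end

section
/- For every finite simple graph G and every vertex v ∈ V(G), the Grundy total domination number of the vertex-deleted subgraph G − v satisfies γ_gr^t(G) − 2 ≤ γ_gr^t(G − v) ≤ γ_gr^t(G). -/
/-- Every pair in `l` is an edge, and no first entry is adjacent to the second entry of a later
pair: the first entries form a legal sequence, and the second entries witness it. -/
def IsWitnessedSeq {V : Type*} (G : SimpleGraph V) (l : List (V × V)) : Prop :=
  (∀ p ∈ l, G.Adj p.1 p.2) ∧ l.Pairwise fun p q => ¬ G.Adj p.1 q.2

theorem IsWitnessedSeq.sublist {V : Type*} {G : SimpleGraph V} {l l' : List (V × V)}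
    (h : IsWitnessedSeq G l) (hl : l'.Sublist l) : IsWitnessedSeq G l' :=
  ⟨fun p hp => h.1 p (hl.subset hp), h.2.sublist hl⟩

theorem isWitnessedSeq_map {V W : Type*} {G : SimpleGraph V} {H : SimpleGraph W} (f : H ↪g G)
    {l : List (W × W)} : IsWitnessedSeq G (l.map (Prod.map f f)) ↔ IsWitnessedSeq H l := by
  simp only [IsWitnessedSeq, List.forall_mem_map, List.pairwise_map, Prod.map_fst, Prod.map_snd,
    f.map_adj_iff]

theorem IsWitnessedSeq.nodup_fst {V : Type*} {G : SimpleGraph V} {l : List (V × V)}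
    (h : IsWitnessedSeq G l) : (l.map Prod.fst).Nodup := by
  refine List.pairwise_map.2 (h.2.imp_of_mem fun {p q} _ hq hpq heq => hpq ?_)
  exact heq ▸ h.1 q hq

theorem IsWitnessedSeq.nodup_snd {V : Type*} {G : SimpleGraph V} {l : List (V × V)}
    (h : IsWitnessedSeq G l) : (l.map Prod.snd).Nodup := by
  refine List.pairwise_map.2 (h.2.imp_of_mem fun {p q} hp _ hpq heq => hpq ?_)
  exact heq ▸ h.1 p hp

theorem exists_isLegalSeq_iff {V : Type*} (G : SimpleGraph V) (n : ℕ) :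
    (∃ s, IsLegalSeq G s ∧ s.length = n) ↔ ∃ l, IsWitnessedSeq G l ∧ l.length = n := by
  constructor
  · rintro ⟨s, ⟨-, hs⟩, rfl⟩
    choose w hw hw' using hs
    refine ⟨List.ofFn fun i => (s.get i, w i), ⟨?_, ?_⟩, List.length_ofFn⟩
    · simpa [List.mem_ofFn] using hw
    · exact List.pairwise_ofFn.2 fun i j hij => hw' j i hij
  · rintro ⟨l, hl, rfl⟩
    refine ⟨l.map Prod.fst, ⟨hl.nodup_fst, fun i => ?_⟩, List.length_map _⟩
    have hi : (i : ℕ) < l.length := by simpa using i.2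
    refine ⟨(l[(i : ℕ)]).2, by simpa using hl.1 _ (List.getElem_mem hi), fun j hij => ?_⟩
    simpa using List.pairwise_iff_getElem.1 hl.2 j i (hij.trans hi) hi hij

theorem IsWitnessedSeq.length_le_grundyTotal {V : Type*} [Finite V] {G : SimpleGraph V}
    {l : List (V × V)} (h : IsWitnessedSeq G l) : l.length ≤ grundyTotal G := by
  have := Fintype.ofFinite V
  refine le_csSup ⟨Fintype.card V, ?_⟩ ((exists_isLegalSeq_iff G _).2 ⟨l, h, rfl⟩)
  rintro _ ⟨s, hs, rfl⟩
  exact hs.1.length_le_card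

theorem exists_isWitnessedSeq_length_eq {V : Type*} [Finite V] (G : SimpleGraph V) :
    ∃ l, IsWitnessedSeq G l ∧ l.length = grundyTotal G := by
  have := Fintype.ofFinite V
  refine (exists_isLegalSeq_iff G _).1 (Nat.sSup_mem
    (s := {n | ∃ s, IsLegalSeq G s ∧ s.length = n})
    ⟨0, [], ⟨List.nodup_nil, fun i => i.elim0⟩, rfl⟩ ⟨Fintype.card V, ?_⟩)
  rintro _ ⟨s, hs, rfl⟩
  exact hs.1.length_le_card

open Classical in
theorem IsWitnessedSeq.length_le_filter_add_two {V : Type*} {G : SimpleGraph V}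
    {l : List (V × V)} (h : IsWitnessedSeq G l) (v : V) :
    l.length ≤ (l.filter fun p => p.1 ≠ v ∧ p.2 ≠ v).length + 2 := by
  have h₁ : l.countP (fun p => p.1 = v) ≤ 1 := by
    simpa [List.count, List.countP_map, Function.comp_def, beq_eq_decide] using
      List.nodup_iff_count_le_one.1 h.nodup_fst v
  have h₂ : l.countP (fun p => p.2 = v) ≤ 1 := by
    simpa [List.count, List.countP_map, Function.comp_def, beq_eq_decide] using
      List.nodup_iff_count_le_one.1 h.nodup_snd v
  have key : ∀ m : List (V × V), m.length ≤ (m.filter fun p => p.1 ≠ v ∧ p.2 ≠ v).length +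
      (m.countP (fun p => p.1 = v) + m.countP (fun p => p.2 = v)) := by
    intro m
    induction m with
    | nil => simp
    | cons p m ih =>
      by_cases hp₁ : p.1 = v <;> by_cases hp₂ : p.2 = v <;>
        simp [hp₁, hp₂] at ih ⊢ <;> omega
  have := key l
  omega

theorem grundyTotal_vertex_deleted {V : Type*} [Fintype V] (G : SimpleGraph V) (v : V) :
    grundyTotal G - 2 ≤ grundyTotal (G.induce {u | u ≠ v}) ∧
    grundyTotal (G.induce {u | u ≠ v}) ≤ grundyTotal G := by
  classical
  constructor
  · obtain ⟨l, hl, hlen⟩ := exists_isWitnessedSeq_length_eq G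
    have hcount := hl.length_le_filter_add_two v
    have hrange : (l.filter fun p => p.1 ≠ v ∧ p.2 ≠ v) ∈ Set.range
        (List.map (Prod.map (SimpleGraph.Embedding.induce (G := G) {u | u ≠ v})
          (SimpleGraph.Embedding.induce (G := G) {u | u ≠ v}))) := by
      rw [Set.range_list_map]
      intro p hp
      have hp' := List.of_mem_filter hp
      simp only [decide_eq_true_eq] at hp'
      exact ⟨(⟨p.1, hp'.1⟩, ⟨p.2, hp'.2⟩), rfl⟩
    obtain ⟨l', hl'⟩ := hrange
    have hw := hl.sublist (List.filter_sublist (p := fun p => p.1 ≠ v ∧ p.2 ≠ v))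
    rw [← hl', isWitnessedSeq_map] at hw
    have hle := hw.length_le_grundyTotal
    rw [← hl', List.length_map] at hcount
    omega
  · obtain ⟨l, hl, hlen⟩ := exists_isWitnessedSeq_length_eq (G.induce {u | u ≠ v})
    have hle := ((isWitnessedSeq_map (SimpleGraph.Embedding.induce _)).2 hl).length_le_grundyTotal
    rwa [List.length_map, hlen] at hle
end

section
/- If v and v' are false twin vertices in a finite simple graph G (i.e., v ≠ v' and N(v) = N(v')), then γ_gr^t(G) = γ_gr^t(G − v'). -/
/-- The footprint condition of a legal sequence already forces its entries to be distinct. -/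
theorem isLegalSeq_of_forall_exists {V : Type*} {G : SimpleGraph V} {s : List V}
    (h : ∀ i : Fin s.length, ∃ w : V, G.Adj (s.get i) w ∧
      ∀ j : Fin s.length, (j : ℕ) < (i : ℕ) → ¬ G.Adj (s.get j) w) : IsLegalSeq G s := by
  refine ⟨List.nodup_iff_injective_get.2 fun i j hij => ?_, h⟩
  rcases lt_trichotomy i j with hlt | heq | hlt
  · obtain ⟨w, hw, hn⟩ := h j
    exact absurd (hij ▸ hw) (hn i hlt)
  · exact heq
  · obtain ⟨w, hw, hn⟩ := h i
    exact absurd (hij ▸ hw) (hn j hlt)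

/-- A map preserving and reflecting adjacency sends legal sequences to legal sequences. -/
theorem IsLegalSeq.map {V W : Type*} {G : SimpleGraph V} {H : SimpleGraph W} (f : V → W)
    (hf : ∀ a b, H.Adj (f a) (f b) ↔ G.Adj a b) {s : List V} (hs : IsLegalSeq G s) :
    IsLegalSeq H (s.map f) := by
  refine isLegalSeq_of_forall_exists fun i => ?_
  obtain ⟨w, hw, hn⟩ := hs.2 (i.cast (List.length_map f))
  refine ⟨f w, ?_, fun j hj => ?_⟩
  · simpa [hf] using hw
  · simpa [hf] using hn (j.cast (List.length_map f)) hj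

/-- Graphs with maps in both directions preserving and reflecting adjacency have the same
Grundy total domination number. -/
theorem grundyTotal_congr {V W : Type*} {G : SimpleGraph V} {H : SimpleGraph W}
    (f : V → W) (g : W → V) (hf : ∀ a b, H.Adj (f a) (f b) ↔ G.Adj a b)
    (hg : ∀ a b, G.Adj (g a) (g b) ↔ H.Adj a b) : grundyTotal G = grundyTotal H := by
  unfold grundyTotal
  congr 1
  ext n
  constructor
  · rintro ⟨s, hs, rfl⟩
    exact ⟨s.map f, hs.map f hf, List.length_map f⟩
  · rintro ⟨s, hs, rfl⟩
    exact ⟨s.map g, hs.map g hg, List.length_map g⟩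

theorem grundyTotal_false_twins {V : Type*} [Fintype V] (G : SimpleGraph V) (v v' : V)
    (hne : v ≠ v') (htwin : G.neighborSet v = G.neighborSet v') :
    grundyTotal G = grundyTotal (G.induce {u | u ≠ v'}) := by
  classical
  have ht : ∀ w, G.Adj v w ↔ G.Adj v' w := fun w => Set.ext_iff.1 htwin w
  have hmem : ∀ u, (if u = v' then v else u) ∈ {u | u ≠ v'} := by
    intro u
    by_cases hu : u = v' <;> simp [hu, hne]
  have hadj : ∀ a w, G.Adj (if a = v' then v else a) w ↔ G.Adj a w := by
    intro a w
    by_cases ha : a = v' <;> simp [ha, ht]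
  refine grundyTotal_congr (fun u => ⟨if u = v' then v else u, hmem u⟩) Subtype.val
    (fun a b => ?_) (fun _ _ => Iff.rfl)
  rw [SimpleGraph.comap_adj]
  exact (hadj a _).trans ((G.adj_comm _ _).trans ((hadj b a).trans (G.adj_comm _ _)))
end

section
/- For every integer n ≥ 4, the prism graph K_n □ K_2 (the Cartesian product of the complete graph on n vertices with the complete graph on 2 vertices) satisfies γ_gr^t(K_n □ K_2) = n. -/
open SimpleGraph

/-- A legal sequence is no longer than the inner dimension of any factorization of the
adjacency matrix over a field. -/
theorem IsLegalSeq.length_le_card_of_factorization {V ι F : Type*} [Fintype ι] [Field F]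
    {G : SimpleGraph V} [DecidableRel G.Adj] (B : Matrix V ι F) (C : Matrix ι V F)
    (hBC : B * C = G.adjMatrix F) {s : List V} (hs : IsLegalSeq G s) :
    s.length ≤ Fintype.card ι := by
  choose w hw hlt using hs.2
  have hM : (B.submatrix s.get id * C.submatrix id w : Matrix (Fin s.length) (Fin s.length) F)
      = (G.adjMatrix F).submatrix s.get w := by
    rw [← hBC]; rfl
  have hdet : ((G.adjMatrix F).submatrix s.get w).det = 1 := by
    rw [Matrix.det_of_isLowerTriangular]
    · exact Finset.prod_eq_one fun i _ => by simpa using hw i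
    · intro i j hij
      have := hlt j i (by simpa using hij)
      simpa using this
  have hrank := Matrix.rank_of_isUnit ((G.adjMatrix F).submatrix s.get w)
    ((Matrix.isUnit_iff_isUnit_det _).2 (by rw [hdet]; exact isUnit_one))
  rw [← hM, Fintype.card_fin] at hrank
  rw [← hrank]
  exact (Matrix.rank_mul_le_left _ _).trans (Matrix.rank_le_card_width _)

/-- In characteristic dividing `n - 2`, the adjacency matrix of the complete graph on `n` vertices
is an involution. -/
theorem sum_complete_adj_mul_complete_adj {n : ℕ} {F : Type*} [Field F] (hF : (n : F) = 2)
    (i j : Fin n) :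
    ∑ k, (if i = k then (0 : F) else 1) * (if k = j then 0 else 1) = if i = j then 1 else 0 := by
  have h (k : Fin n) : (if i = k then (0 : F) else 1) * (if k = j then 0 else 1)
      = 1 - (if i = k then 1 else 0) - (if k = j then 1 else 0)
        + (if i = k then (if k = j then 1 else 0) else 0) := by
    split_ifs <;> simp
  simp only [h, Finset.sum_add_distrib, Finset.sum_sub_distrib, Finset.sum_ite_eq,
    Finset.sum_ite_eq', Finset.mem_univ, if_true, Finset.sum_const, Finset.card_univ,
    Fintype.card_fin, nsmul_eq_mul, mul_one, hF]
  ring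

theorem IsLegalSeq.length_le_of_prism {n : ℕ} (hn : 4 ≤ n) {s : List (Fin n × Fin 2)}
    (hs : IsLegalSeq ((⊤ : SimpleGraph (Fin n)) □ (⊤ : SimpleGraph (Fin 2))) s) :
    s.length ≤ n := by
  classical
  obtain ⟨p, hp, hpn⟩ := Nat.exists_prime_and_dvd (n := n - 2) (by omega)
  have := Fact.mk hp
  have hF : (n : ZMod p) = 2 := by
    have h : ((n - 2 : ℕ) : ZMod p) = 0 := (ZMod.natCast_eq_zero_iff _ _).2 hpn
    rw [Nat.cast_sub (by omega)] at h
    simpa [sub_eq_zero] using h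
  have key := hs.length_le_card_of_factorization (ι := Fin n) (F := ZMod p)
    (Matrix.of fun v k => if v.2 = 0 then (if v.1 = k then 0 else 1) else
      (if v.1 = k then 1 else 0))
    (Matrix.of fun k v => if v.2 = 0 then (if k = v.1 then 1 else 0) else
      (if k = v.1 then 0 else 1)) (by
    ext ⟨i, a⟩ ⟨j, b⟩
    have hX := sum_complete_adj_mul_complete_adj hF i j
    fin_cases a <;> fin_cases b
    · simp [Matrix.mul_apply, SimpleGraph.boxProd_adj, ite_not]
    · simpa [Matrix.mul_apply, SimpleGraph.boxProd_adj] using hX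
    · simp [Matrix.mul_apply, SimpleGraph.boxProd_adj]
    · simp [Matrix.mul_apply, SimpleGraph.boxProd_adj, -mul_ite, ite_not])
  simpa using key

theorem isLegalSeq_prism_layer (n : ℕ) :
    IsLegalSeq ((⊤ : SimpleGraph (Fin n)) □ (⊤ : SimpleGraph (Fin 2)))
      (List.ofFn fun i : Fin n => (i, (0 : Fin 2))) := by
  refine ⟨List.nodup_ofFn.2 fun i j h => congrArg Prod.fst h, fun i => ?_⟩
  refine ⟨(⟨i, by simpa using i.2⟩, 1), by simp [SimpleGraph.boxProd_adj], fun j hj => ?_⟩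
  simp [SimpleGraph.boxProd_adj, Fin.ext_iff]
  omega

theorem grundyTotal_prism (n : ℕ) (hn : 4 ≤ n) :
    grundyTotal ((⊤ : SimpleGraph (Fin n)) □ (⊤ : SimpleGraph (Fin 2))) = n := by
  refine IsGreatest.csSup_eq ⟨⟨_, isLegalSeq_prism_layer n, by simp⟩, ?_⟩
  rintro _ ⟨s, hs, rfl⟩
  exact hs.length_le_of_prism hn
end

section
/- For every positive integer n with n ≠ 1 and n ≠ 3, there exists a finite simple graph G with γ_gr^t(G) = n; moreover, there is no finite simple graph G with γ_gr^t(G) = 1 and no finite simple graph G with γ_gr^t(G) = 3. -/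
namespace IsLegalSeq

variable {V : Type*} {G : SimpleGraph V}

/-- A family of vertices with private witnesses is automatically free of repetitions. -/
theorem ofFn {k : ℕ} (f w : Fin k → V) (hadj : ∀ i, G.Adj (f i) (w i))
    (hpriv : ∀ i j, j < i → ¬ G.Adj (f j) (w i)) : IsLegalSeq G (List.ofFn f) := by
  refine ⟨List.nodup_ofFn.mpr fun i j hij => ?_, fun i => ?_⟩
  · rcases lt_trichotomy i j with h | h | h
    · exact absurd (hij ▸ hadj j) (hpriv j i h)
    · exact h
    · exact absurd (hij ▸ hadj i) (hpriv i j h)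
  · refine ⟨w (i.cast List.length_ofFn), ?_, fun j hj => ?_⟩
    · rw [List.get_ofFn]
      exact hadj _
    · rw [List.get_ofFn]
      exact hpriv _ _ hj

theorem length_le_card [Fintype V] {s : List V} (hs : IsLegalSeq G s) :
    s.length ≤ Fintype.card V :=
  hs.1.length_le_card

/-- The last vertex of a legal sequence through all vertices would have a witness of degree one. -/
theorem length_lt_card [Fintype V] [Nonempty V]
    (hdeg : ∀ v, ∃ a b, a ≠ b ∧ G.Adj a v ∧ G.Adj b v) {s : List V} (hs : IsLegalSeq G s) :
    s.length < Fintype.card V := by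
  classical
  refine lt_of_le_of_ne hs.length_le_card fun hcard => ?_
  have hmem : ∀ v, v ∈ s := fun v => by
    have : s.toFinset = Finset.univ := by
      rw [← Finset.card_eq_iff_eq_univ, List.toFinset_card_of_nodup hs.1, hcard]
    simpa using this.ge (Finset.mem_univ v)
  have hpos : 0 < s.length := hcard ▸ Fintype.card_pos
  obtain ⟨w, -, hpriv⟩ := hs.2 ⟨s.length - 1, by omega⟩
  have hlast : ∀ a, G.Adj a w → a = s.get ⟨s.length - 1, by omega⟩ := fun a ha => by
    obtain ⟨j, rfl⟩ := List.mem_iff_get.mp (hmem a)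
    by_contra hne
    have hj : (j : ℕ) ≠ s.length - 1 := fun h => hne (congrArg s.get (Fin.ext h))
    exact hpriv j (by simp only; omega) ha
  obtain ⟨a, b, hab, ha, hb⟩ := hdeg w
  exact hab ((hlast a ha).trans (hlast b hb).symm)

end IsLegalSeq

section Bounds

variable {V : Type*} [Fintype V] {G : SimpleGraph V}

theorem bddAbove_legalSeq_length (G : SimpleGraph V) :
    BddAbove {n | ∃ s : List V, IsLegalSeq G s ∧ s.length = n} :=
  ⟨Fintype.card V, by rintro n ⟨s, hs, rfl⟩; exact hs.length_le_card⟩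

theorem exists_isLegalSeq_length_eq_grundyTotal (G : SimpleGraph V) :
    ∃ s : List V, IsLegalSeq G s ∧ s.length = grundyTotal G :=
  Nat.sSup_mem (s := {n | ∃ s : List V, IsLegalSeq G s ∧ s.length = n})
    ⟨0, [], ⟨List.nodup_nil, fun i => i.elim0⟩, rfl⟩ (bddAbove_legalSeq_length G)

theorem le_grundyTotal {k : ℕ} (f w : Fin k → V) (hadj : ∀ i, G.Adj (f i) (w i))
    (hpriv : ∀ i j, j < i → ¬ G.Adj (f j) (w i)) : k ≤ grundyTotal G :=
  le_csSup (bddAbove_legalSeq_length G) ⟨_, .ofFn f w hadj hpriv, List.length_ofFn⟩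

theorem grundyTotal_lt_card [Nonempty V] (hdeg : ∀ v, ∃ a b, a ≠ b ∧ G.Adj a v ∧ G.Adj b v) :
    grundyTotal G < Fintype.card V := by
  obtain ⟨s, hs, hlen⟩ := exists_isLegalSeq_length_eq_grundyTotal G
  exact hlen ▸ hs.length_lt_card hdeg

theorem two_le_grundyTotal_of_adj {u v : V} (h : G.Adj u v) : 2 ≤ grundyTotal G :=
  le_grundyTotal ![u, v] ![v, u] (by simp [Fin.forall_fin_succ, h, h.symm])
    (by simp [Fin.forall_fin_succ])

/-- An edge `yz` and a non-isolated vertex `x` adjacent to neither end give a legal sequence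
of length four. -/
theorem four_le_grundyTotal {x y z t : V} (hxt : G.Adj x t) (hyz : G.Adj y z)
    (hxy : ¬ G.Adj x y) (hxz : ¬ G.Adj x z) : 4 ≤ grundyTotal G :=
  le_grundyTotal ![x, y, z, t] ![t, z, y, x]
    (by simp [Fin.forall_fin_succ, hxt, hyz, hxt.symm, hyz.symm])
    (by simp [Fin.forall_fin_succ, hxy, hxz, G.adj_comm y x, G.adj_comm z x])

theorem grundyTotal_ne_one (G : SimpleGraph V) : grundyTotal G ≠ 1 := fun h => by
  obtain ⟨s, hs, hlen⟩ := exists_isLegalSeq_length_eq_grundyTotal G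
  obtain ⟨w, hw, -⟩ := hs.2 ⟨0, by omega⟩
  have := two_le_grundyTotal_of_adj hw
  omega

theorem grundyTotal_ne_three (G : SimpleGraph V) : grundyTotal G ≠ 3 := fun h => by
  obtain ⟨s, hs, hlen⟩ := exists_isLegalSeq_length_eq_grundyTotal G
  obtain ⟨w₀, h₀, -⟩ := hs.2 ⟨0, by omega⟩
  obtain ⟨w₁, h₁, hpriv₁⟩ := hs.2 ⟨1, by omega⟩
  obtain ⟨w₂, h₂, hpriv₂⟩ := hs.2 ⟨2, by omega⟩
  have h₀₁ := hpriv₁ ⟨0, by omega⟩ Nat.zero_lt_one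
  have h₀₂ := hpriv₂ ⟨0, by omega⟩ Nat.zero_lt_two
  have h₁₂ := hpriv₂ ⟨1, by omega⟩ Nat.one_lt_two
  have : 4 ≤ grundyTotal G := by
    by_cases hw : G.Adj w₁ w₂
    · exact four_le_grundyTotal h₀ hw h₀₁ h₀₂
    · exact four_le_grundyTotal h₂.symm h₁ (fun h => h₁₂ h.symm) (fun h => hw h.symm)
  omega

end Bounds

/-- The path `0, 1, …, n` with both ends closed up to triangles by the edges `0 2` and
`(n - 2) n`. -/
def trianglePath (n : ℕ) : SimpleGraph (Fin (n + 1)) where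
  Adj a b := (a : ℕ) + 1 = b ∨ (b : ℕ) + 1 = a ∨ ((a : ℕ) = 0 ∧ (b : ℕ) = 2) ∨
    ((b : ℕ) = 0 ∧ (a : ℕ) = 2) ∨ ((a : ℕ) + 2 = n ∧ (b : ℕ) = n) ∨
    ((b : ℕ) + 2 = n ∧ (a : ℕ) = n)
  symm := ⟨fun a b h => by omega⟩
  loopless := ⟨fun a h => by omega⟩

theorem grundyTotal_trianglePath {n : ℕ} (hn : 4 ≤ n) : grundyTotal (trianglePath n) = n := by
  refine le_antisymm ?_ ?_
  · rw [← Nat.lt_succ_iff]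
    refine (grundyTotal_lt_card fun v => ?_).trans_eq (Fintype.card_fin _)
    by_cases h0 : (v : ℕ) = 0
    · exact ⟨⟨1, by omega⟩, ⟨2, by omega⟩, by simp, by grind [trianglePath],
        by grind [trianglePath]⟩
    by_cases hv : (v : ℕ) = n
    · exact ⟨⟨n - 1, by omega⟩, ⟨n - 2, by omega⟩, by simp; omega,
        by grind [trianglePath], by grind [trianglePath]⟩
    · exact ⟨⟨v - 1, by omega⟩, ⟨v + 1, by omega⟩, by simp,
        by grind [trianglePath], by simp [trianglePath]⟩
  · -- Skip the vertex `n - 2`; the first two and the last two vertices witness each other.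
    refine le_grundyTotal
      (fun i => if (i : ℕ) + 2 < n then ⟨i, by omega⟩ else ⟨i + 1, by omega⟩)
      (fun i => if (i : ℕ) = 1 then ⟨0, by omega⟩ else
        if (i : ℕ) + 1 = n then ⟨n - 1, by omega⟩ else
        if (i : ℕ) + 2 = n then ⟨n, by omega⟩ else ⟨i + 1, by omega⟩) ?_ ?_
    · intro i
      dsimp only [trianglePath]
      split_ifs <;> grind
    · intro i j hij
      have hij : (j : ℕ) < i := hij
      dsimp only [trianglePath]
      split_ifs <;> grind

theorem grundyTotal_top_fin_three : grundyTotal (⊤ : SimpleGraph (Fin 3)) = 2 := by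
  refine le_antisymm ?_ (two_le_grundyTotal_of_adj (u := 0) (v := 1) (by simp))
  rw [← Nat.lt_succ_iff]
  refine (grundyTotal_lt_card ?_).trans_eq (Fintype.card_fin _)
  simp only [SimpleGraph.top_adj]
  decide

theorem grundyTotal_realization :
    (∀ n : ℕ, 0 < n → n ≠ 1 → n ≠ 3 →
      ∃ (V : Type) (_ : Fintype V) (G : SimpleGraph V), grundyTotal G = n) ∧
    (∀ (V : Type) [Fintype V] (G : SimpleGraph V), grundyTotal G ≠ 1 ∧ grundyTotal G ≠ 3) := by
  refine ⟨fun n h0 h1 h3 => ?_, fun V _ G => ⟨grundyTotal_ne_one G, grundyTotal_ne_three G⟩⟩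
  obtain rfl | hn : n = 2 ∨ 4 ≤ n := by omega
  · exact ⟨Fin 3, inferInstance, ⊤, grundyTotal_top_fin_three⟩
  · exact ⟨Fin (n + 1), inferInstance, trianglePath n, grundyTotal_trianglePath hn⟩
end

section
/- For any two finite non-empty simple graphs G_1 and G_2 on disjoint vertex sets, the join G_1 ∨ G_2 satisfies γ_gr^t(G_1 ∨ G_2) = max{γ_gr^t(G_1) + 2·η(G_1), γ_gr^t(G_2) + 2·η(G_2)}, where η(H) = 1 if H has an isolated vertex and η(H) = 0 otherwise. -/
open SimpleGraph

/-- The join of two graphs: their disjoint union together with all edges between the parts. -/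
def joinGraph {V₁ V₂ : Type*} (G₁ : SimpleGraph V₁) (G₂ : SimpleGraph V₂) :
    SimpleGraph (V₁ ⊕ V₂) :=
  SimpleGraph.fromRel (fun x y =>
    match x, y with
    | .inl a, .inl b => G₁.Adj a b
    | .inr a, .inr b => G₂.Adj a b
    | .inl _, .inr _ => True
    | .inr _, .inl _ => False)

open Classical in
/-- `eta G = 1` if `G` has an isolated vertex, and `0` otherwise. -/
noncomputable def eta {V : Type*} (G : SimpleGraph V) : ℕ :=
  if ∃ v : V, ∀ u : V, ¬ G.Adj v u then 1 else 0

namespace SimpleGraph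

variable {V W V₁ V₂ : Type*}

/-- `s` is a legal sequence in `G` once the vertices of `D` are already totally dominated: each
term has a neighbor outside `D` which is not adjacent to any earlier term. -/
def LegalFrom (G : SimpleGraph V) : Set V → List V → Prop
  | _, [] => True
  | D, v :: s => (∃ w ∉ D, G.Adj v w) ∧ LegalFrom G (D ∪ G.neighborSet v) s

variable {G : SimpleGraph V} {D E : Set V} {s t : List V}

theorem LegalFrom.mono (h : D ⊆ E) (hs : G.LegalFrom E s) : G.LegalFrom D s := by
  induction s generalizing D E with
  | nil => trivial
  | cons v s ih =>
    obtain ⟨⟨w, hw, hvw⟩, hs⟩ := hs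
    exact ⟨⟨w, fun hD => hw (h hD), hvw⟩, ih (Set.union_subset_union_left _ h) hs⟩

theorem legalFrom_append :
    G.LegalFrom D (s ++ t) ↔
      G.LegalFrom D s ∧ G.LegalFrom (D ∪ {w | ∃ v ∈ s, G.Adj v w}) t := by
  induction s generalizing D with
  | nil => simp [LegalFrom]
  | cons v s ih =>
    have h : D ∪ G.neighborSet v ∪ {w | ∃ u ∈ s, G.Adj u w} =
        D ∪ {w | ∃ u ∈ v :: s, G.Adj u w} := by
      ext w
      simp [or_assoc]
    simp only [List.cons_append, LegalFrom, ih, h, and_assoc]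

theorem legalFrom_singleton {v : V} : G.LegalFrom D [v] ↔ ∃ w ∉ D, G.Adj v w := by
  simp [LegalFrom]

theorem LegalFrom.eq_nil (h : ∀ v, v ∈ D) (hs : G.LegalFrom D s) : s = [] := by
  cases s with
  | nil => rfl
  | cons v s =>
    obtain ⟨⟨w, hw, -⟩, -⟩ := hs
    exact absurd (h w) hw

theorem LegalFrom.notMem {v : V} (hv : G.neighborSet v ⊆ D) (hs : G.LegalFrom D s) : v ∉ s := by
  induction s generalizing D with
  | nil => simp
  | cons u s ih =>
    obtain ⟨⟨w, hw, huw⟩, hs⟩ := hs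
    rw [List.mem_cons, not_or]
    refine ⟨?_, ih (hv.trans Set.subset_union_left) hs⟩
    rintro rfl
    exact hw (hv huw)

theorem LegalFrom.nodup (hs : G.LegalFrom D s) : s.Nodup := by
  induction s generalizing D with
  | nil => simp
  | cons v s ih => exact List.nodup_cons.2 ⟨hs.2.notMem Set.subset_union_right, ih hs.2⟩

theorem legalFrom_iff :
    G.LegalFrom D s ↔ ∀ i : Fin s.length, ∃ w, w ∉ D ∧ G.Adj (s.get i) w ∧
      ∀ j : Fin s.length, (j : ℕ) < (i : ℕ) → ¬ G.Adj (s.get j) w := by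
  induction s generalizing D with
  | nil => simp [LegalFrom]
  | cons v s ih =>
    simp only [LegalFrom, ih, List.length_cons, Fin.forall_fin_succ]
    simp [and_assoc, and_left_comm]

theorem isLegalSeq_iff : IsLegalSeq G s ↔ G.LegalFrom ∅ s := by
  refine ⟨fun h => legalFrom_iff.2 (by simpa using h.2), fun h => ⟨h.nodup, ?_⟩⟩
  simpa using legalFrom_iff.1 h

theorem grundyTotal_le {n : ℕ} (h : ∀ s, G.LegalFrom ∅ s → s.length ≤ n) :
    grundyTotal G ≤ n := by
  refine csSup_le' ?_
  rintro _ ⟨s, hs, rfl⟩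
  exact h s (isLegalSeq_iff.1 hs)

theorem bddAbove_length_isLegalSeq [Finite V] (G : SimpleGraph V) :
    BddAbove {n | ∃ s : List V, IsLegalSeq G s ∧ s.length = n} := by
  have := Fintype.ofFinite V
  refine ⟨Fintype.card V, ?_⟩
  rintro _ ⟨s, hs, rfl⟩
  exact hs.1.length_le_card

theorem LegalFrom.length_le_grundyTotal [Finite V] (hs : G.LegalFrom D s) :
    s.length ≤ grundyTotal G :=
  le_csSup (bddAbove_length_isLegalSeq G)
    ⟨s, isLegalSeq_iff.2 (hs.mono (Set.empty_subset D)), rfl⟩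

theorem exists_legalFrom_length_eq_grundyTotal [Finite V] (G : SimpleGraph V) :
    ∃ s, G.LegalFrom ∅ s ∧ s.length = grundyTotal G := by
  obtain ⟨s, hs, h⟩ := Nat.sSup_mem (s := {n | ∃ s : List V, IsLegalSeq G s ∧ s.length = n})
    ⟨0, [], isLegalSeq_iff.2 trivial, rfl⟩ (bddAbove_length_isLegalSeq G)
  exact ⟨s, isLegalSeq_iff.1 hs, h⟩

theorem legalFrom_map_iso {H : SimpleGraph W} (e : G ≃g H) {D : Set W} :
    H.LegalFrom D (s.map e) ↔ G.LegalFrom (e ⁻¹' D) s := by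
  induction s generalizing D with
  | nil => simp [LegalFrom]
  | cons v s ih =>
    have h : e ⁻¹' (D ∪ H.neighborSet (e v)) = e ⁻¹' D ∪ G.neighborSet v := by
      ext w
      simp [e.map_adj_iff]
    simp [LegalFrom, ih, h, e.surjective.exists, e.map_adj_iff]

theorem LegalFrom.exists_iso {H : SimpleGraph W} (e : G ≃g H) (hs : G.LegalFrom ∅ s) :
    ∃ t, H.LegalFrom ∅ t ∧ t.length = s.length :=
  ⟨s.map e, (legalFrom_map_iso e).2 (by simpa using hs), by simp⟩

theorem eta_eq_one {v : V} (hv : ∀ u, ¬ G.Adj v u) : eta G = 1 :=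
  if_pos ⟨v, hv⟩

variable {G₁ : SimpleGraph V₁} {G₂ : SimpleGraph V₂}

@[simp]
theorem joinGraph_adj_inl_inl {a b : V₁} :
    (joinGraph G₁ G₂).Adj (.inl a) (.inl b) ↔ G₁.Adj a b := by
  simp only [joinGraph, fromRel_adj, G₁.adj_comm b a, or_self, and_iff_right_iff_imp]
  intro h
  simpa using h.ne

@[simp]
theorem joinGraph_adj_inr_inr {a b : V₂} :
    (joinGraph G₁ G₂).Adj (.inr a) (.inr b) ↔ G₂.Adj a b := by
  simp only [joinGraph, fromRel_adj, G₂.adj_comm b a, or_self, and_iff_right_iff_imp]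
  intro h
  simpa using h.ne

@[simp]
theorem joinGraph_adj_inl_inr (a : V₁) (b : V₂) : (joinGraph G₁ G₂).Adj (.inl a) (.inr b) := by
  simp [joinGraph]

@[simp]
theorem joinGraph_adj_inr_inl (b : V₂) (a : V₁) : (joinGraph G₁ G₂).Adj (.inr b) (.inl a) :=
  (joinGraph_adj_inl_inr a b).symm

/-- The join of graphs is commutative up to isomorphism. -/
def joinGraphComm (G₁ : SimpleGraph V₁) (G₂ : SimpleGraph V₂) :
    joinGraph G₁ G₂ ≃g joinGraph G₂ G₁ :=
  ⟨Equiv.sumComm V₁ V₂, by rintro (a | a) (b | b) <;> simp⟩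

theorem preimage_inl_union_neighborSet (D : Set (V₁ ⊕ V₂)) (v : V₁) :
    Sum.inl ⁻¹' (D ∪ (joinGraph G₁ G₂).neighborSet (.inl v)) =
      Sum.inl ⁻¹' D ∪ G₁.neighborSet v := by
  ext w
  simp

theorem LegalFrom.map_inl {D : Set (V₁ ⊕ V₂)} {s : List V₁}
    (hs : G₁.LegalFrom (Sum.inl ⁻¹' D) s) :
    (joinGraph G₁ G₂).LegalFrom D (s.map .inl) := by
  induction s generalizing D with
  | nil => trivial
  | cons v s ih =>
    obtain ⟨⟨w, hw, hvw⟩, hs⟩ := hs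
    exact ⟨⟨.inl w, hw, by simpa using hvw⟩,
      ih (by rwa [preimage_inl_union_neighborSet])⟩

/-- Once the right part of a join is dominated, a legal sequence stays in the left part, except
possibly for its last term. -/
theorem LegalFrom.join_cases {D : Set (V₁ ⊕ V₂)} {t : List (V₁ ⊕ V₂)}
    (hD : ∀ b, Sum.inr b ∈ D) (ht : (joinGraph G₁ G₂).LegalFrom D t) :
    ∃ s : List V₁, G₁.LegalFrom (Sum.inl ⁻¹' D) s ∧
      (t.length = s.length ∨ t.length = s.length + 1 ∧
        ∃ w, .inl w ∉ D ∧ ∀ v ∈ s, ¬ G₁.Adj v w) := by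
  induction t generalizing D with
  | nil => exact ⟨[], trivial, .inl rfl⟩
  | cons x t ih =>
    obtain ⟨⟨w, hw, hxw⟩, ht⟩ := ht
    obtain w | b := w
    swap
    · exact absurd (hD b) hw
    obtain v | b := x
    · obtain ⟨s, hs, h⟩ := ih (fun b => .inl (hD b)) ht
      rw [preimage_inl_union_neighborSet] at hs
      refine ⟨v :: s, ⟨⟨w, hw, by simpa using hxw⟩, hs⟩, ?_⟩
      obtain h | ⟨h, u, hu, hsu⟩ := h
      · exact .inl (by simp [h])
      · simp only [Set.mem_union, mem_neighborSet, joinGraph_adj_inl_inl, not_or] at hu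
        exact .inr ⟨by simp [h], u, hu.1, by simpa using ⟨hu.2, hsu⟩⟩
    · have h : t = [] := ht.eq_nil (by rintro (a | a) <;> simp [hD])
      exact ⟨[], trivial, .inr ⟨by simp [h], w, hw, by simp⟩⟩

theorem LegalFrom.length_cons_inl_le [Finite V₁] {x : V₁} {t : List (V₁ ⊕ V₂)}
    (ht : (joinGraph G₁ G₂).LegalFrom ∅ (.inl x :: t)) :
    (Sum.inl x :: t).length ≤ grundyTotal G₁ + 2 * eta G₁ := by
  obtain ⟨s, hs, h⟩ := ht.2.join_cases (by simp)
  rw [preimage_inl_union_neighborSet, Set.preimage_empty] at hs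
  have hle := hs.length_le_grundyTotal
  rw [List.length_cons]
  by_cases hx : ∀ u, ¬ G₁.Adj x u
  · rw [eta_eq_one hx]
    omega
  push Not at hx
  have hxs : G₁.LegalFrom ∅ (x :: s) := ⟨by simpa using hx, hs⟩
  obtain h | ⟨h, w, hw, hsw⟩ := h
  · have := hxs.length_le_grundyTotal
    rw [List.length_cons] at this
    omega
  by_cases hw' : ∀ u, ¬ G₁.Adj w u
  · rw [eta_eq_one hw']
    omega
  push Not at hw'
  obtain ⟨u, hu⟩ := hw'
  have hxsu : G₁.LegalFrom ∅ (x :: s ++ [u]) := by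
    refine legalFrom_append.2 ⟨hxs, legalFrom_singleton.2 ⟨w, ?_, hu.symm⟩⟩
    simpa using And.intro (by simpa using hw) hsw
  have := hxsu.length_le_grundyTotal
  simp only [List.length_append, List.length_cons, List.length_nil] at this
  omega

theorem grundyTotal_add_two_mul_eta_le_joinGraph [Finite V₁] [Finite V₂] [Nonempty V₂]
    (G₁ : SimpleGraph V₁) (G₂ : SimpleGraph V₂) :
    grundyTotal G₁ + 2 * eta G₁ ≤ grundyTotal (joinGraph G₁ G₂) := by
  obtain ⟨s, hs, hlen⟩ := exists_legalFrom_length_eq_grundyTotal G₁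
  rw [← hlen]
  by_cases h : ∃ v, ∀ u, ¬ G₁.Adj v u
  · obtain ⟨v, hv⟩ := h
    obtain ⟨b⟩ := ‹Nonempty V₂›
    have hv' : G₁.neighborSet v = ∅ := by
      ext u
      simpa using hv u
    have hJ : (joinGraph G₁ G₂).LegalFrom ∅ (.inl v :: (s.map .inl ++ [.inr b])) := by
      refine ⟨⟨.inr b, by simp⟩, legalFrom_append.2 ⟨LegalFrom.map_inl ?_, ?_⟩⟩
      · rwa [preimage_inl_union_neighborSet, hv', Set.preimage_empty, Set.union_empty]
      · refine legalFrom_singleton.2 ⟨.inl v, ?_, by simp⟩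
        simp only [Set.mem_union, Set.mem_empty_iff_false, mem_neighborSet, SimpleGraph.irrefl,
          Set.mem_ofPred_eq, List.mem_map, false_or, not_exists, not_and]
        rintro _ ⟨u, -, rfl⟩
        simpa [G₁.adj_comm] using hv u
    have := hJ.length_le_grundyTotal
    simp only [List.length_cons, List.length_append, List.length_map, List.length_nil] at this
    rw [eta_eq_one hv]
    omega
  · have hJ : (joinGraph G₁ G₂).LegalFrom ∅ (s.map .inl) := LegalFrom.map_inl (by simpa using hs)
    simpa [eta, h] using hJ.length_le_grundyTotal

end SimpleGraph

theorem grundyTotal_join {V₁ V₂ : Type*} [Fintype V₁] [Fintype V₂]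
    [Nonempty V₁] [Nonempty V₂] (G₁ : SimpleGraph V₁) (G₂ : SimpleGraph V₂) :
    grundyTotal (joinGraph G₁ G₂) =
      max (grundyTotal G₁ + 2 * eta G₁) (grundyTotal G₂ + 2 * eta G₂) := by
  refine le_antisymm (grundyTotal_le fun t ht => ?_) (max_le ?_ ?_)
  · match t, ht with
    | [], _ => exact Nat.zero_le _
    | .inl x :: t, ht => exact le_max_of_le_left ht.length_cons_inl_le
    | .inr x :: t, ht =>
      have h := (legalFrom_map_iso (joinGraphComm G₁ G₂) (D := ∅)).2 ht
      simpa using le_max_of_le_right (LegalFrom.length_cons_inl_le h)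
  · exact grundyTotal_add_two_mul_eta_le_joinGraph G₁ G₂
  · refine (grundyTotal_add_two_mul_eta_le_joinGraph G₂ G₁).trans (grundyTotal_le fun t ht => ?_)
    obtain ⟨s, hs, h⟩ := ht.exists_iso (joinGraphComm G₂ G₁)
    exact h ▸ hs.length_le_grundyTotal
end

section
/- For every finite tree T (a connected acyclic graph), the Grundy total domination number satisfies γ_gr^t(T) = 2·τ(T), where τ(T) is the vertex cover number of T. -/
open SimpleGraph

/-- A list of pairs `(v, w)` in which `v` is adjacent to `w`, and `w` is not adjacent to the first
entry of any earlier pair. -/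
def IsFootprintList {V : Type*} (G : SimpleGraph V) (l : List (V × V)) : Prop :=
  (∀ p ∈ l, G.Adj p.1 p.2) ∧ l.Pairwise fun p q => ¬ G.Adj p.1 q.2

namespace IsFootprintList

variable {V : Type*} {G : SimpleGraph V} {l : List (V × V)}

theorem nodup_map_fst (h : IsFootprintList G l) : (l.map Prod.fst).Nodup := by
  rw [List.Nodup, List.pairwise_map]
  exact h.2.imp_of_mem fun _ hq hpq heq => hpq (heq ▸ h.1 _ hq)

theorem nodup_map_snd (h : IsFootprintList G l) : (l.map Prod.snd).Nodup := by
  rw [List.Nodup, List.pairwise_map]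
  exact h.2.imp_of_mem fun hp _ hpq heq => hpq (heq ▸ h.1 _ hp)

theorem isLegalSeq (h : IsFootprintList G l) : IsLegalSeq G (l.map Prod.fst) := by
  refine ⟨h.nodup_map_fst, fun i => ?_⟩
  have hi : (i : ℕ) < l.length := by simpa using i.isLt
  refine ⟨l[(i : ℕ)].2, by simpa using h.1 _ (List.getElem_mem hi), fun j hji => ?_⟩
  have hj : (j : ℕ) < l.length := by simpa using j.isLt
  simpa using List.pairwise_iff_getElem.mp h.2 j i hj hi hji

theorem length_le_two_mul_ncard [Finite V] (h : IsFootprintList G l) {S : Set V}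
    (hS : G.IsVertexCover S) : l.length ≤ 2 * S.ncard := by
  classical
  have := Fintype.ofFinite V
  have card_le (l' : List V) (hl' : l'.Nodup) (hsub : ∀ v ∈ l', v ∈ S) :
      l'.length ≤ S.ncard := by
    rw [← List.toFinset_card_of_nodup hl', ← Set.ncard_coe_finset]
    exact Set.ncard_le_ncard (fun v hv => hsub v (by simpa using hv)) S.toFinite
  have hfst := card_le ((l.filter (·.1 ∈ S)).map Prod.fst)
    (h.nodup_map_fst.sublist (List.filter_sublist.map _)) (by simp)
  have hsnd := card_le ((l.filter (¬ ·.1 ∈ S)).map Prod.snd)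
    (h.nodup_map_snd.sublist (List.filter_sublist.map _)) (by
      simp only [List.mem_map, List.mem_filter, decide_eq_true_eq]
      rintro _ ⟨p, ⟨hp, hpS⟩, rfl⟩
      exact (hS (h.1 p hp)).resolve_left hpS)
  have hlen := List.length_eq_length_filter_add (l := l) (fun p => decide (p.1 ∈ S))
  simp only [List.length_map, decide_not] at hfst hsnd
  omega

/-- A footprint list of the graph obtained by isolating the neighbor `u` of a leaf `v` extends by
two pairs. -/
theorem extend {u v : V} (huv : G.Adj u v) (hv : ∀ w, G.Adj v w → w = u)
    (h : IsFootprintList (G.deleteIncidenceSet u) l) :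
    IsFootprintList G ((v, u) :: (l ++ [(u, v)])) := by
  have hadj {p : V × V} (hp : p ∈ l) := deleteIncidenceSet_adj.mp (h.1 p hp)
  refine ⟨?_, ?_⟩
  · simp only [List.mem_cons, List.mem_append, List.not_mem_nil, or_false]
    rintro p (rfl | hp | rfl)
    exacts [huv.symm, (hadj hp).1, huv]
  · simp only [List.pairwise_cons, List.pairwise_append, List.mem_append, List.mem_singleton]
    refine ⟨?_, ?_, by simp, ?_⟩
    · rintro p (hp | rfl) hvp
      exacts [(hadj hp).2.2 (hv _ hvp), G.loopless.irrefl v hvp]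
    · exact h.2.imp_of_mem fun hp hq hpq hG =>
        hpq (deleteIncidenceSet_adj.mpr ⟨hG, (hadj hp).2.1, (hadj hq).2.2⟩)
    · rintro p hp _ rfl hpv
      exact (hadj hp).2.1 (hv _ hpv.symm)

end IsFootprintList

theorem IsLegalSeq.exists_isFootprintList {V : Type*} {G : SimpleGraph V} {s : List V}
    (h : IsLegalSeq G s) : ∃ l, IsFootprintList G l ∧ l.length = s.length := by
  choose w hw hw' using h.2
  refine ⟨List.ofFn fun i => (s.get i, w i), ⟨?_, ?_⟩, by simp⟩
  · rintro _ hp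
    obtain ⟨i, rfl⟩ := List.mem_ofFn.mp hp
    exact hw i
  · rw [List.pairwise_ofFn]
    exact fun j i hji => hw' i j hji

/-- A finite acyclic graph with an edge has a leaf. -/
theorem SimpleGraph.IsAcyclic.exists_leaf {V : Type*} [Finite V] {G : SimpleGraph V}
    (hG : G.IsAcyclic) (hne : G ≠ ⊥) : ∃ u v, G.Adj u v ∧ ∀ w, G.Adj v w → w = u := by
  obtain ⟨a, b, hab⟩ := ne_bot_iff_exists_adj.mp hne
  have : Nonempty V := ⟨a⟩
  obtain ⟨x, v, p, hp, hmax⟩ := Walk.exists_isPath_forall_isPath_length_le_length G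
  have hlen : 1 ≤ p.length := hmax a b hab.toWalk (Path.singleton hab).2
  have hnil : ¬ p.Nil := fun h => by
    have := Walk.length_eq_zero_iff.mpr h
    omega
  refine ⟨p.penultimate, v, p.adj_penultimate hnil, fun w hvw => ?_⟩
  refine hG.eq_penultimate_of_adj_end hp hvw (by_contra fun hw => ?_)
  have := hmax _ _ _ (hp.concat hw hvw)
  rw [Walk.length_concat] at this
  omega

theorem SimpleGraph.IsAcyclic.exists_isFootprintList_isVertexCover {V : Type*} [Finite V]
    {G : SimpleGraph V} (hG : G.IsAcyclic) :
    ∃ l S, IsFootprintList G l ∧ G.IsVertexCover S ∧ 2 * S.ncard ≤ l.length := by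
  induction G using WellFoundedLT.induction with
  | ind G ih =>
    obtain rfl | hne := eq_or_ne G ⊥
    · exact ⟨[], ∅, by simp [IsFootprintList], by simp, by simp⟩
    obtain ⟨u, v, huv, hv⟩ := hG.exists_leaf hne
    have hle := G.deleteIncidenceSet_le u
    have hlt : G.deleteIncidenceSet u < G :=
      lt_of_le_not_ge hle fun h => (deleteIncidenceSet_adj.mp (h huv)).2.1 rfl
    obtain ⟨l, S, hl, hS, hcard⟩ := ih _ hlt (hG.anti hle)
    refine ⟨_, insert u S, hl.extend huv hv, fun a b hab => ?_, ?_⟩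
    · by_cases ha : a = u
      · exact .inl (.inl ha)
      by_cases hb : b = u
      · exact .inr (.inl hb)
      exact (hS (deleteIncidenceSet_adj.mpr ⟨hab, ha, hb⟩)).imp .inr .inr
    · have := Set.ncard_insert_le u S
      simp only [List.length_cons, List.length_append, List.length_nil]
      omega

theorem grundyTotal_tree {V : Type*} [Fintype V] (T : SimpleGraph V)
    (hconn : T.Connected) (hacyc : T.IsAcyclic) :
    grundyTotal T = 2 * vertexCoverNumber T := by
  have upper {n : ℕ} (hn : ∃ s : List V, IsLegalSeq T s ∧ s.length = n) {S : Set V}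
      (hS : T.IsVertexCover S) : n ≤ 2 * S.ncard := by
    obtain ⟨s, hs, rfl⟩ := hn
    obtain ⟨l, hl, hlen⟩ := hs.exists_isFootprintList
    exact hlen ▸ hl.length_le_two_mul_ncard hS
  obtain ⟨l, S, hl, hS, hcard⟩ := hacyc.exists_isFootprintList_isVertexCover
  apply le_antisymm
  · obtain ⟨C, hC, hcover⟩ := Nat.sInf_mem
      (s := {n | ∃ S : Set V, S.ncard = n ∧ ∀ ⦃u w : V⦄, T.Adj u w → u ∈ S ∨ w ∈ S})
      ⟨_, S, rfl, fun _ _ h => hS h⟩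
    rw [vertexCoverNumber, ← hC]
    exact csSup_le' fun n hn => upper hn fun _ _ h => hcover h
  · calc 2 * vertexCoverNumber T ≤ 2 * S.ncard :=
          Nat.mul_le_mul_left 2 (Nat.sInf_le ⟨S, rfl, fun _ _ h => hS h⟩)
      _ ≤ l.length := hcard
      _ ≤ grundyTotal T := le_csSup ⟨2 * S.ncard, fun _ hn => upper hn hS⟩
          ⟨_, hl.isLegalSeq, by simp⟩
end

section
/- If G is a finite connected simple graph whose Grundy total domination number γ_gr^t(G) is odd, then |E(G)| ≥ |V(G)| + 1. -/
namespace GrundyTotal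

open Finset

section Legal

variable {V : Type*} {G : SimpleGraph V}

lemma isLegalSeq_nil : IsLegalSeq G [] :=
  ⟨List.nodup_nil, fun i => i.elim0⟩

lemma isLegalSeq_append_singleton {s : List V} {r : V} :
    IsLegalSeq G (s ++ [r]) ↔
      IsLegalSeq G s ∧ r ∉ s ∧ ∃ w, G.Adj r w ∧ ∀ v ∈ s, ¬ G.Adj v w := by
  constructor
  · rintro ⟨hnd, h⟩
    have hnd' := List.nodup_append.1 hnd
    refine ⟨⟨hnd'.1, fun i => ?_⟩, fun hr => hnd'.2.2 r hr r (by simp) rfl, ?_⟩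
    · obtain ⟨w, hw, hw'⟩ := h ⟨i, by simp⟩
      refine ⟨w, by simpa using hw, fun j hj => ?_⟩
      simpa using hw' ⟨j, by simp⟩ hj
    · obtain ⟨w, hw, hw'⟩ := h ⟨s.length, by simp⟩
      refine ⟨w, by simpa using hw, fun v hv => ?_⟩
      obtain ⟨j, hj, rfl⟩ := List.getElem_of_mem hv
      simpa [List.getElem_append_left hj] using hw' ⟨j, by simp; omega⟩ hj
  · rintro ⟨⟨hnd, h⟩, hr, w, hw, hw'⟩
    refine ⟨by simpa [List.nodup_append, hnd] using
      fun a ha (h : a = r) => hr (h ▸ ha), ?_⟩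
    rintro ⟨i, hi⟩
    rcases lt_or_eq_of_le (Nat.le_of_lt_succ (by simpa using hi)) with his | rfl
    · obtain ⟨w, hw, hw'⟩ := h ⟨i, his⟩
      refine ⟨w, by simpa [List.getElem_append_left his] using hw, ?_⟩
      rintro ⟨j, hj⟩ hji
      have hjs : j < s.length := lt_trans hji his
      simpa [List.getElem_append_left hjs] using hw' ⟨j, hjs⟩ hji
    · refine ⟨w, by simpa using hw, ?_⟩
      rintro ⟨j, hj⟩ hji
      simpa [List.getElem_append_left (show j < s.length from hji)] using
        hw' _ (List.getElem_mem hji)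

end Legal

/-- A loopless symmetric matrix over `ZMod 2` of odd order is singular. -/
lemma det_eq_zero_of_odd {n : ℕ} (hn : Odd n) {M : Matrix (Fin n) (Fin n) (ZMod 2)}
    (hM : M.IsSymm) (hdiag : ∀ i, M i i = 0) : M.det = 0 := by
  let S : Matrix (Fin n) (Fin n) ℤ := Matrix.of fun i j =>
    if i < j then ((M i j).val : ℤ) else if j < i then -((M i j).val : ℤ) else 0
  have hS : S.transpose = -S := by
    ext i j
    have := hM.apply i j
    rcases lt_trichotomy i j with h | rfl | h
    · simp [S, this, h, not_lt_of_gt h]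
    · simp [S]
    · simp [S, this, h, not_lt_of_gt h]
  have hdet : S.det = 0 := by
    have := S.det_transpose
    rw [hS, Matrix.det_neg, Fintype.card_fin, hn.neg_one_pow] at this
    omega
  have hmap : M = S.map (Int.castRingHom (ZMod 2)) := by
    ext i j
    rcases lt_trichotomy i j with h | rfl | h
    · simp [S, h]
    · simp [S, hdiag]
    · simp [S, h, not_lt_of_gt h, ZMod.neg_eq_self_mod_two]
  rw [hmap, ← RingHom.mapMatrix_apply, ← RingHom.map_det, hdet, map_zero]

section Adjacency

variable {V : Type*} (G : SimpleGraph V) [DecidableRel G.Adj]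

/-- A basis of the row space of the adjacency matrix over `ZMod 2` selects a nonsingular
principal submatrix. -/
lemma eq_zero_of_principal {R : Finset V}
    (hind : LinearIndepOn (ZMod 2) (G.adjMatrix (ZMod 2)).row (R : Set V))
    (hspan : ∀ v, (G.adjMatrix (ZMod 2)).row v ∈
      Submodule.span (ZMod 2) ((G.adjMatrix (ZMod 2)).row '' (R : Set V)))
    (x : V → ZMod 2) (hx : ∀ c ∈ R, ∑ r ∈ R, x r * G.adjMatrix (ZMod 2) r c = 0) :
    ∀ r ∈ R, x r = 0 := by
  refine linearIndepOn_finset_iff.1 hind x ?_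
  have hall : ∀ a ∈ Submodule.span (ZMod 2) ((G.adjMatrix (ZMod 2)).row '' (R : Set V)),
      ∑ r ∈ R, x r * a r = 0 := by
    intro a ha
    induction ha using Submodule.span_induction with
    | mem a ha =>
      obtain ⟨c, hc, rfl⟩ := ha
      simpa only [Matrix.row_apply, SimpleGraph.adjMatrix_apply, G.adj_comm c] using hx c hc
    | zero => simp
    | add a b _ _ ha hb => simp [mul_add, sum_add_distrib, ha, hb]
    | smul k a _ ha => simp [mul_left_comm, ← mul_sum, ha]
  funext v
  simpa only [Finset.sum_apply, Pi.smul_apply, smul_eq_mul, Matrix.row_apply,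
    SimpleGraph.adjMatrix_apply, G.adj_comm v, Pi.zero_apply] using hall _ (hspan v)

variable [DecidableEq V]

/-- The rows of the adjacency matrix over `ZMod 2` indexed by a legal sequence are independent. -/
lemma linearIndepOn_of_isLegalSeq {s : List V} (hs : IsLegalSeq G s) :
    LinearIndepOn (ZMod 2) (G.adjMatrix (ZMod 2)).row (s.toFinset : Set V) := by
  induction s using List.reverseRecOn with
  | nil => simp
  | append_singleton s r ih =>
    obtain ⟨hs, hr, w, hw, hw'⟩ := isLegalSeq_append_singleton.1 hs
    have ih := linearIndepOn_finset_iff.1 (ih hs)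
    have hfin : (s ++ [r]).toFinset = insert r s.toFinset := by ext; simp
    rw [hfin, linearIndepOn_finset_iff]
    intro x hx
    rw [sum_insert (by simpa using hr)] at hx
    have hxr : x r = 0 := by
      have := congrFun hx w
      rw [Pi.add_apply, Finset.sum_apply, sum_eq_zero] at this
      · simpa [hw] using this
      · intro v hv
        simp [hw' v (by simpa using hv)]
    rw [hxr, zero_smul, zero_add] at hx
    intro v hv
    rcases mem_insert.1 hv with rfl | hv
    · exact hxr
    · exact ih x hx v hv

/-- If every edge `uv` satisfies `f u = v` or `f v = u`, then `R` and `C` span at most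
`#R + #C` adjacent pairs. -/
lemma sum_card_adj_le {f : V → V} (hf : ∀ u v, G.Adj u v → f u = v ∨ f v = u)
    (R C : Finset V) : ∑ c ∈ C, #{r ∈ R | G.Adj r c} ≤ #R + #C := by
  rw [← card_sigma]
  have hsub : (C.sigma fun c => {r ∈ R | G.Adj r c}) ⊆
      R.image (fun r => ⟨f r, r⟩) ∪ C.image (fun c => (⟨c, f c⟩ : Σ _ : V, V)) := by
    rintro ⟨c, r⟩ h
    simp only [mem_sigma, mem_filter] at h
    obtain ⟨hc, hr, hrc⟩ := h
    rcases hf r c hrc with rfl | rfl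
    · exact mem_union_left _ (mem_image_of_mem _ hr)
    · exact mem_union_right _ (mem_image_of_mem _ hc)
  exact (card_le_card hsub).trans
    ((card_union_le _ _).trans (add_le_add card_image_le card_image_le))

/-- A submatrix of the adjacency matrix of a pseudoforest that is nonsingular over `ZMod 2`
can be made triangular by permuting rows and columns. -/
lemma exists_isLegalSeq_of_nonsingular {f : V → V}
    (hf : ∀ u v, G.Adj u v → f u = v ∨ f v = u) (n : ℕ) (R C : Finset V)
    (hR : #R = n) (hC : #C = n)
    (hrow : ∀ x : V → ZMod 2, (∀ c ∈ C, ∑ r ∈ R, x r * G.adjMatrix (ZMod 2) r c = 0) →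
      ∀ r ∈ R, x r = 0)
    (hcol : ∀ y : V → ZMod 2, (∀ r ∈ R, ∑ c ∈ C, G.adjMatrix (ZMod 2) r c * y c = 0) →
      ∀ c ∈ C, y c = 0) :
    ∃ s : List V, IsLegalSeq G s ∧ s.toFinset = R := by
  induction n generalizing R C with
  | zero => exact ⟨[], isLegalSeq_nil, by simp [card_eq_zero.1 hR]⟩
  | succ n ih =>
    obtain ⟨c, hc, hdeg⟩ : ∃ c ∈ C, #{r ∈ R | G.Adj r c} = 1 := by
      by_contra! hne
      have hpos : ∀ c ∈ C, #{r ∈ R | G.Adj r c} ≠ 0 := by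
        intro c hc h0
        have h0' := filter_eq_empty_iff.1 (card_eq_zero.1 h0)
        have := hcol (Pi.single c 1) (fun r hr => sum_eq_zero fun c' _ => ?_) c hc
        · simp at this
        · by_cases h : c' = c
          · subst h; simp [h0' hr]
          · simp [h]
      have htwo : ∀ c ∈ C, 2 ≤ #{r ∈ R | G.Adj r c} := fun c hc => by
        have := hpos c hc; have := hne c hc; omega
      have heq : ∀ c ∈ C, 2 = #{r ∈ R | G.Adj r c} := by
        refine (sum_eq_sum_iff_of_le htwo).1 (le_antisymm (sum_le_sum htwo) ?_)
        have := sum_card_adj_le G hf R C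
        simp only [sum_const, smul_eq_mul]
        omega
      obtain ⟨r, hr⟩ : R.Nonempty := card_pos.1 (by omega)
      refine one_ne_zero (hrow (fun _ => 1) (fun c hc => ?_) r hr)
      simp only [one_mul, SimpleGraph.adjMatrix_apply, sum_boole, ← heq c hc]
      rfl
    obtain ⟨r, hr⟩ := card_eq_one.1 hdeg
    have hmem (v : V) : v ∈ R ∧ G.Adj v c ↔ v = r := by
      simpa using Finset.ext_iff.1 hr v
    obtain ⟨hrR, hrc⟩ := (hmem r).2 rfl
    have hother : ∀ v ∈ R.erase r, ¬ G.Adj v c := fun v hv h =>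
      (mem_erase.1 hv).1 ((hmem v).1 ⟨(mem_erase.1 hv).2, h⟩)
    obtain ⟨s, hs, hsR⟩ := ih (R.erase r) (C.erase c)
      (by rw [card_erase_of_mem hrR]; omega) (by rw [card_erase_of_mem hc]; omega) (by
        intro x hx v hv
        have := hrow (Function.update x r 0) (fun c' hc' => ?_) v (mem_erase.1 hv).2
        · rwa [Function.update_of_ne (mem_erase.1 hv).1] at this
        rw [← add_sum_erase _ _ hrR, Function.update_self, zero_mul, zero_add]
        by_cases h : c' = c
        · subst h
          exact sum_eq_zero fun v hv => by simp [hother v hv]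
        · rw [← hx c' (mem_erase.2 ⟨h, hc'⟩)]
          exact sum_congr rfl fun v hv => by rw [Function.update_of_ne (mem_erase.1 hv).1]) (by
        intro y hy v hv
        set t := ∑ c' ∈ C.erase c, G.adjMatrix (ZMod 2) r c' * y c' with ht
        have := hcol (Function.update y c (-t)) (fun r' hr' => ?_) v (mem_erase.1 hv).2
        · rwa [Function.update_of_ne (mem_erase.1 hv).1] at this
        rw [← add_sum_erase _ _ hc, Function.update_self,
          sum_congr rfl fun v hv => by rw [Function.update_of_ne (mem_erase.1 hv).1]]
        by_cases h : r' = r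
        · subst h
          rw [← ht, SimpleGraph.adjMatrix_apply, if_pos hrc, one_mul, neg_add_cancel]
        · have hr'' := mem_erase.2 ⟨h, hr'⟩
          rw [hy r' hr'']
          simp [hother r' hr''])
    refine ⟨s ++ [r], isLegalSeq_append_singleton.2 ⟨hs, ?_, c, hrc, fun v hv => ?_⟩, ?_⟩
    · rw [← List.mem_toFinset, hsR]; simp
    · exact hother v (by rwa [← hsR, List.mem_toFinset])
    · rw [List.toFinset_append, hsR]
      ext v
      by_cases h : v = r <;> simp [h, hrR]

lemma even_card_of_nonsingular_principal {R : Finset V}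
    (hR : ∀ x : V → ZMod 2, (∀ c ∈ R, ∑ r ∈ R, x r * G.adjMatrix (ZMod 2) r c = 0) →
      ∀ r ∈ R, x r = 0) : Even #R := by
  by_contra hodd
  rw [Nat.not_even_iff_odd] at hodd
  let e := R.equivFin
  let M : Matrix (Fin #R) (Fin #R) (ZMod 2) :=
    Matrix.of fun i j => G.adjMatrix (ZMod 2) (e.symm i) (e.symm j)
  have hdet : M.det = 0 := det_eq_zero_of_odd hodd
    (by ext i j; simp [M, G.adj_comm]) (by simp [M])
  obtain ⟨z, hz, hMz⟩ := Matrix.exists_vecMul_eq_zero_iff.2 hdet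
  refine hz (funext fun i => ?_)
  let x : V → ZMod 2 := fun v => if h : v ∈ R then z (e ⟨v, h⟩) else 0
  have hxe : ∀ r : R, x r = z (e r) := fun r => by simp [x]
  have := hR x (fun c hc => ?_) (e.symm i) (e.symm i).2
  · simpa [hxe] using this
  · rw [← sum_coe_sort R, ← e.symm.sum_comp]
    have := congrFun hMz (e ⟨c, hc⟩)
    simpa [Matrix.vecMul, dotProduct, M, hxe] using this

/-- The Grundy total domination number of a pseudoforest is even. -/
theorem even_grundyTotal [Fintype V] {f : V → V} (hf : ∀ u v, G.Adj u v → f u = v ∨ f v = u) :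
    Even (grundyTotal G) := by
  obtain ⟨b, -, -, hspan, hind⟩ := exists_linearIndepOn_extension
    (linearIndepOn_empty (ZMod 2) (G.adjMatrix (ZMod 2)).row) (Set.empty_subset Set.univ)
  lift b to Finset V using b.toFinite
  replace hspan : ∀ v, (G.adjMatrix (ZMod 2)).row v ∈
      Submodule.span (ZMod 2) ((G.adjMatrix (ZMod 2)).row '' (b : Set V)) :=
    fun v => hspan (Set.mem_image_of_mem _ (Set.mem_univ v))
  have hns := eq_zero_of_principal G hind hspan
  obtain ⟨s, hs, hsb⟩ := exists_isLegalSeq_of_nonsingular G hf #b b b rfl rfl hns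
    (fun y hy => hns y fun c hc => by
      simpa only [mul_comm (y _), SimpleGraph.adjMatrix_apply, G.adj_comm c] using hy c hc)
  have hgreatest : IsGreatest {n | ∃ s : List V, IsLegalSeq G s ∧ s.length = n} #b := by
    refine ⟨⟨s, hs, by rw [← hsb, List.toFinset_card_of_nodup hs.1]⟩, ?_⟩
    rintro _ ⟨t, ht, rfl⟩
    have hcard (c : Finset V)
        (hc : LinearIndepOn (ZMod 2) (G.adjMatrix (ZMod 2)).row (c : Set V)) :
        Module.finrank (ZMod 2) (Submodule.span (ZMod 2)
          ((G.adjMatrix (ZMod 2)).row '' (c : Set V))) = #c := by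
      rw [Set.image_eq_range]
      exact (finrank_span_eq_card hc).trans (by simp)
    rw [← List.toFinset_card_of_nodup ht.1, ← hcard _ (linearIndepOn_of_isLegalSeq G ht),
      ← hcard b hind]
    refine Submodule.finrank_mono (Submodule.span_le.2 ?_)
    rintro _ ⟨v, -, rfl⟩
    exact hspan v
  rw [grundyTotal, hgreatest.csSup_eq]
  exact even_card_of_nonsingular_principal G hns

end Adjacency

section Pseudoforest

variable {V : Type*} [Fintype V] {T : SimpleGraph V}

/-- In a tree, every vertex other than the root `a` has a parent, and every edge joins a vertex
to its parent. -/
lemma exists_parent_of_isTree (hT : T.IsTree) (a : V) :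
    ∃ p : V → V, ∀ u v, T.Adj u v → (u ≠ a ∧ p u = v) ∨ (v ≠ a ∧ p v = u) := by
  classical
  have hex : ∀ v, ∃ w, v ≠ a → T.Adj v w ∧ T.dist w a < T.dist v a := by
    intro v
    by_cases hv : v = a
    · exact ⟨v, fun h => (h hv).elim⟩
    obtain ⟨q, hq⟩ := hT.connected.exists_walk_length_eq_dist v a
    cases q with
    | nil => exact (hv rfl).elim
    | @cons _ w _ h q =>
      refine ⟨w, fun _ => ⟨h, ?_⟩⟩
      have := SimpleGraph.dist_le q
      rw [SimpleGraph.Walk.length_cons] at hq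
      omega
  choose p hp using hex
  refine ⟨p, fun u v huv => ?_⟩
  have hinj : Set.InjOn (fun v => s(v, p v)) (univ.erase a : Finset V) := by
    intro u hu v hv huv
    have hu := (hp u (by simpa using hu)).2
    have hv := (hp v (by simpa using hv)).2
    rcases Sym2.eq_iff.1 huv with h | ⟨h₁, h₂⟩
    · exact h.1
    · rw [h₂] at hu
      rw [← h₁] at hv
      exact (lt_asymm hu hv).elim
  have himage : (univ.erase a).image (fun v => s(v, p v)) = T.edgeFinset := by
    refine eq_of_subset_of_card_le ?_ ?_
    · intro e he
      obtain ⟨v, hv, rfl⟩ := mem_image.1 he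
      simpa using (hp v (by simpa using hv)).1
    · rw [card_image_of_injOn hinj, card_erase_of_mem (mem_univ a), card_univ,
        ← hT.card_edgeFinset]
      simp
  have huv' : s(u, v) ∈ (univ.erase a).image (fun v => s(v, p v)) := by
    rw [himage]; simpa using huv
  obtain ⟨w, hw, h⟩ := mem_image.1 huv'
  have hw : w ≠ a := by simpa using hw
  rcases Sym2.eq_iff.1 h with ⟨rfl, h'⟩ | ⟨rfl, h'⟩
  · exact Or.inl ⟨hw, h'⟩
  · exact Or.inr ⟨hw, h'⟩

/-- The edges of a connected graph with at most as many edges as vertices can be assigned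
injectively to end vertices. -/
lemma exists_assignment {G : SimpleGraph V} (hconn : G.Connected)
    (hcard : G.edgeSet.ncard ≤ Fintype.card V) :
    ∃ f : V → V, ∀ u v, G.Adj u v → f u = v ∨ f v = u := by
  classical
  obtain ⟨T, hle, hT⟩ := hconn.exists_isTree_le
  by_cases hGT : ∃ a b, G.Adj a b ∧ ¬ T.Adj a b
  · obtain ⟨a, b, hab, hab'⟩ := hGT
    obtain ⟨p, hp⟩ := exists_parent_of_isTree hT a
    refine ⟨Function.update p a b, fun u v huv => ?_⟩
    by_cases hTuv : T.Adj u v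
    · rcases hp u v hTuv with ⟨h, h'⟩ | ⟨h, h'⟩ <;> simp [h, h']
    · have hdiff : #(G.edgeFinset \ T.edgeFinset) ≤ 1 := by
        rw [card_sdiff_of_subset (SimpleGraph.edgeFinset_subset_edgeFinset.2 hle)]
        have := hT.card_edgeFinset
        rw [Set.ncard_eq_toFinset_card'] at hcard
        change #G.edgeFinset ≤ _ at hcard
        omega
      have heq : s(u, v) = s(a, b) :=
        card_le_one.1 hdiff _ (by simp [huv, hTuv]) _ (by simp [hab, hab'])
      rcases Sym2.eq_iff.1 heq with ⟨rfl, rfl⟩ | ⟨rfl, rfl⟩ <;> simp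
  · push Not at hGT
    obtain ⟨a⟩ := hconn.nonempty
    obtain ⟨p, hp⟩ := exists_parent_of_isTree hT a
    exact ⟨p, fun u v huv => (hp u v (hGT u v huv)).imp And.right And.right⟩

end Pseudoforest

end GrundyTotal

theorem edges_ge_vertices_add_one_of_odd_grundyTotal {V : Type*} [Fintype V]
    (G : SimpleGraph V) (hconn : G.Connected) (hodd : Odd (grundyTotal G)) :
    Fintype.card V + 1 ≤ G.edgeSet.ncard := by
  classical
  by_contra! hlt
  obtain ⟨f, hf⟩ := GrundyTotal.exists_assignment hconn (Nat.le_of_lt_succ hlt)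
  exact Nat.not_even_iff_odd.2 hodd (GrundyTotal.even_grundyTotal G hf)
end

section
/- Let G be a thick spider graph of weight r ≥ 3, i.e., V(G) is partitioned into S = {s_1,…,s_r}, C = {c_1,…,c_r}, and H (possibly empty), where S is a stable set, C is a clique, every vertex of H is adjacent to every vertex of C, no vertex of H is adjacent to any vertex of S, and s_i is adjacent to c_j if and only if i ≠ j. Then γ_gr^t(G) = γ_gr^t(G[H]) + 4, where G[H] is the subgraph of G induced by H. -/
namespace IsLegalSeq

variable {V : Type*} {G : SimpleGraph V}

/-- A legal sequence has a footprint function: every vertex is adjacent to its footprint, which no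
earlier vertex is adjacent to. -/
theorem exists_footprint {l : List V} (hl : IsLegalSeq G l) :
    ∃ f : V → V, (∀ v ∈ l, G.Adj v (f v)) ∧ l.Pairwise fun u v => ¬ G.Adj u (f v) := by
  obtain ⟨hnd, h⟩ := hl
  have key : ∀ v : V, ∃ w : V, v ∈ l → G.Adj v w ∧
      ∀ i j : Fin l.length, l.get j = v → i < j → ¬ G.Adj (l.get i) w := by
    intro v
    by_cases hv : v ∈ l
    · obtain ⟨k, rfl⟩ := List.get_of_mem hv
      obtain ⟨w, hw, hw'⟩ := h k
      refine ⟨w, fun _ => ⟨hw, fun i j hj hij => hw' i ?_⟩⟩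
      rw [← hnd.injective_get hj]
      exact hij
    · exact ⟨v, fun hv' => absurd hv' hv⟩
  choose f hf using key
  refine ⟨f, fun v hv => (hf v hv).1, List.pairwise_iff_get.2 fun i j hij => ?_⟩
  exact (hf _ (List.get_mem l j)).2 i j rfl hij

/-- A family of vertices with footprints enumerates a legal sequence. -/
theorem map_of_footprint {ι : Type*} {l : List ι} {g f : ι → V}
    (hadj : ∀ i ∈ l, G.Adj (g i) (f i)) (hl : l.Pairwise fun i j => ¬ G.Adj (g i) (f j)) :
    IsLegalSeq G (l.map g) := by
  constructor
  · refine List.pairwise_map.2 (hl.imp_of_mem fun {i j} _ hj hij h => hij ?_)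
    rw [h]
    exact hadj j hj
  · intro i
    have hi : (i : ℕ) < l.length := by simpa using i.2
    refine ⟨f l[i], ?_, fun j hj => ?_⟩
    · simpa using hadj _ (List.getElem_mem hi)
    · simpa using List.pairwise_iff_getElem.1 hl j i (hj.trans hi) hi hj

theorem bddAbove_length [Finite V] (G : SimpleGraph V) :
    BddAbove {n | ∃ l : List V, IsLegalSeq G l ∧ l.length = n} := by
  have := Fintype.ofFinite V
  refine ⟨Fintype.card V, ?_⟩
  rintro n ⟨l, hl, rfl⟩
  exact hl.1.length_le_card

theorem nonempty_length (G : SimpleGraph V) :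
    {n | ∃ l : List V, IsLegalSeq G l ∧ l.length = n}.Nonempty :=
  ⟨0, [], ⟨List.nodup_nil, fun i => i.elim0⟩, rfl⟩

theorem length_le_grundyTotal [Finite V] {l : List V} (hl : IsLegalSeq G l) :
    l.length ≤ grundyTotal G :=
  le_csSup (bddAbove_length G) ⟨l, hl, rfl⟩

theorem exists_length_eq_grundyTotal [Finite V] (G : SimpleGraph V) :
    ∃ l : List V, IsLegalSeq G l ∧ l.length = grundyTotal G :=
  Nat.sSup_mem (nonempty_length G) (bddAbove_length G)

end IsLegalSeq

theorem grundyTotal_le {V : Type*} {G : SimpleGraph V} {n : ℕ}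
    (h : ∀ l : List V, IsLegalSeq G l → l.length ≤ n) : grundyTotal G ≤ n := by
  refine csSup_le (IsLegalSeq.nonempty_length G) ?_
  rintro _ ⟨l, hl, rfl⟩
  exact h l hl

/-- If any two distinct vertices satisfying `p` together dominate the footprints of all vertices
satisfying `p`, then at most two such vertices occur in a legal sequence. -/
theorem length_filter_le_two {V : Type*} {G : SimpleGraph V} {l : List V} {f : V → V}
    (hnd : l.Nodup) (hf : l.Pairwise fun u v => ¬ G.Adj u (f v)) (p : V → Prop) [DecidablePred p]
    (hp : ∀ a b d, p a → p b → a ≠ b → d ∈ l → p d → G.Adj a (f d) ∨ G.Adj b (f d)) :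
    (l.filter p).length ≤ 2 := by
  have hnd' := hnd.filter p
  have hf' := hf.filter p
  have hmem : ∀ x ∈ l.filter p, x ∈ l ∧ p x := fun x hx => by simpa using hx
  generalize l.filter p = m at *
  match m with
  | [] | [_] | [_, _] => simp
  | a :: b :: d :: _ =>
    exfalso
    simp only [List.nodup_cons, List.pairwise_cons, List.mem_cons, not_or] at *
    have ha := hmem a (by simp)
    have hb := hmem b (by simp)
    have hd := hmem d (by simp)
    rcases hp a b d ha.2 hb.2 hnd'.1.1 hd.1 hd.2 with h | h
    · exact hf'.1 d (by simp) h
    · exact hf'.2.1 d (by simp) h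

/-- The vertices of a legal sequence lying in `H` and having their footprint in `H` form a legal
sequence of the graph induced on `H`. -/
theorem length_filter_le_grundyTotal_induce {V : Type*} [Finite V] {G : SimpleGraph V}
    {l : List V} {f : V → V} (hadj : ∀ v ∈ l, G.Adj v (f v))
    (hf : l.Pairwise fun u v => ¬ G.Adj u (f v)) (H : Set V)
    [DecidablePred fun v => v ∈ H ∧ f v ∈ H] :
    (l.filter fun v => v ∈ H ∧ f v ∈ H).length ≤ grundyTotal (G.induce H) := by
  have hf' := hf.filter fun v => v ∈ H ∧ f v ∈ H
  have hmem : ∀ x ∈ l.filter (fun v => v ∈ H ∧ f v ∈ H), x ∈ l ∧ x ∈ H ∧ f x ∈ H :=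
    fun x hx => by simpa using hx
  generalize l.filter (fun v => v ∈ H ∧ f v ∈ H) = m at *
  lift m to List {v // v ∈ l ∧ v ∈ H ∧ f v ∈ H} using hmem
  have := (IsLegalSeq.map_of_footprint (G := G.induce H) (l := m)
    (g := fun v => ⟨v.1, v.2.2.1⟩) (f := fun v => ⟨f v.1, v.2.2.2⟩)
    (fun v _ => hadj v.1 v.2.1) (List.pairwise_map.1 hf')).length_le_grundyTotal
  simpa using this

theorem grundyTotal_thick_spider {V : Type*} [Fintype V] (G : SimpleGraph V)
    (r : ℕ) (hr : 3 ≤ r) (s c : Fin r → V) (H : Set V)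
    -- the parts S = range s, C = range c and H form a partition of V(G):
    (hs : Function.Injective s) (hc : Function.Injective c)
    (hsc : ∀ i j, s i ≠ c j)
    (hsH : ∀ i, s i ∉ H) (hcH : ∀ i, c i ∉ H)
    (hcover : ∀ v : V, (∃ i, v = s i) ∨ (∃ i, v = c i) ∨ v ∈ H)
    -- S is a stable set:
    (hstable : ∀ i j, ¬ G.Adj (s i) (s j))
    -- C is a clique:
    (hclique : ∀ i j, i ≠ j → G.Adj (c i) (c j))
    -- H is completely joined to C:
    (hHC : ∀ v ∈ H, ∀ i, G.Adj v (c i))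
    -- no vertex of H is adjacent to a vertex of S:
    (hHS : ∀ v ∈ H, ∀ i, ¬ G.Adj v (s i))
    -- thick spider condition:
    (hthick : ∀ i j, G.Adj (s i) (c j) ↔ i ≠ j) :
    grundyTotal G = grundyTotal (G.induce H) + 4 := by
  apply le_antisymm
  · refine grundyTotal_le fun l hl => ?_
    classical
    obtain ⟨f, hadj, hf⟩ := hl.exists_footprint
    have hC : (l.filter fun v => ∃ i, v = c i).length ≤ 2 := by
      refine length_filter_le_two hl.1 hf _ ?_
      rintro _ _ d ⟨i, rfl⟩ ⟨j, rfl⟩ hij - -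
      have hij : i ≠ j := fun h => hij (congrArg c h)
      rcases hcover (f d) with ⟨k, hk⟩ | ⟨k, hk⟩ | hk
      · simp only [hk, G.adj_comm _ (s k), hthick]
        grind
      · rw [hk]
        by_cases hik : i = k
        · exact .inr (hclique j k (hik ▸ hij.symm))
        · exact .inl (hclique i k hik)
      · exact .inl (hHC _ hk i).symm
    have hSH : (l.filter fun v => (∃ i, v = s i) ∨ v ∈ H ∧ f v ∉ H).length ≤ 2 := by
      refine length_filter_le_two hl.1 hf _ fun a b d ha hb hab hd hpd => ?_
      obtain ⟨k, hk⟩ : ∃ k, f d = c k := by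
        have hdf := hadj d hd
        rcases hcover (f d) with ⟨k, hk⟩ | hk | hk
        · rw [hk] at hdf
          rcases hpd with ⟨i, rfl⟩ | hpd
          · exact absurd hdf (hstable i k)
          · exact absurd hdf (hHS d hpd.1 k)
        · exact hk
        · rcases hpd with ⟨i, rfl⟩ | hpd
          · exact absurd hdf.symm (hHS _ hk i)
          · exact absurd hk hpd.2
      rw [hk]
      rcases ha with ⟨i, rfl⟩ | ha
      · rcases hb with ⟨j, rfl⟩ | hb
        · simp only [hthick]
          grind
        · exact .inr (hHC b hb.1 k)
      · exact .inl (hHC a ha.1 k)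
    have hH := length_filter_le_grundyTotal_induce hadj hf H
    have hsplit : l.length ≤ (l.filter fun v => ∃ i, v = c i).length +
        (l.filter fun v => (∃ i, v = s i) ∨ v ∈ H ∧ f v ∉ H).length +
        (l.filter fun v => v ∈ H ∧ f v ∈ H).length := by
      clear hH hSH hC hf hadj hl
      induction l with
      | nil => simp
      | cons v l ih =>
        have hv := hcover v
        simp only [List.filter_cons, List.length_cons]
        grind
    lia
  · obtain ⟨l, hl, hlen⟩ := IsLegalSeq.exists_length_eq_grundyTotal (G.induce H)
    obtain ⟨f, hadj, hf⟩ := hl.exists_footprint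
    obtain ⟨i, j, hij⟩ : ∃ i j : Fin r, i ≠ j :=
      ⟨⟨0, by lia⟩, ⟨1, by lia⟩, by simp⟩
    have hlegal : IsLegalSeq G
        (([(s i, c j), (s j, c i)] ++ (l.map fun v : H => ((v : V), (f v : V))) ++
          [(c i, s j), (c j, s i)]).map Prod.fst) := by
      apply IsLegalSeq.map_of_footprint (f := Prod.snd)
      · simp only [List.mem_append, List.mem_cons, List.mem_map, List.not_mem_nil, or_false]
        rintro _ (((rfl | rfl) | ⟨v, hv, rfl⟩) | (rfl | rfl))
        · exact (hthick i j).2 hij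
        · exact (hthick j i).2 hij.symm
        · exact hadj v hv
        · exact ((hthick j i).2 hij.symm).symm
        · exact ((hthick i j).2 hij).symm
      · have hl' : (l.map fun v : H => ((v : V), (f v : V))).Pairwise
            fun p q => ¬ G.Adj p.1 q.2 := List.pairwise_map.2 hf
        have hSH : ∀ k, ∀ v ∈ H, ¬ G.Adj (s k) v := fun k v hv h => hHS v hv k h.symm
        have hCS : ¬ G.Adj (c i) (s i) := fun h => (hthick i i).1 h.symm rfl
        simp only [List.pairwise_append, List.pairwise_cons, List.mem_append, List.mem_cons,
          List.mem_map, List.not_mem_nil, or_false]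
        grind
    have := hlegal.length_le_grundyTotal
    simp only [List.length_map, List.length_append, List.length_cons, List.length_nil] at this
    lia
end

section
/- For every integer n ≥ 2, the path graph P_n on n vertices satisfies γ_gr^t(P_n) = 2·⌊n/2⌋. -/
/-- A legal sequence containing every vertex of a path forces the path to have even order. -/
theorem IsLegalSeq.even_of_length_eq {n : ℕ} {s : List (Fin n)}
    (hs : IsLegalSeq (SimpleGraph.pathGraph n) s) (hlen : s.length = n) : Even n := by
  obtain ⟨w, hw, hadj⟩ := hs.exists_injective_adj
  have hcard : Fintype.card (Fin s.length) = Fintype.card (Fin n) := by simp [hlen]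
  have hsum (f : Fin s.length → Fin n) (hf : Function.Injective f) :
      ∑ i, (f i : ℕ) = ∑ v : Fin n, (v : ℕ) :=
    ((Fintype.bijective_iff_injective_and_card f).2 ⟨hf, hcard⟩).sum_comp (fun v => (v : ℕ))
  have hodd (i : Fin s.length) : Odd ((s.get i : ℕ) + w i) := by
    have := SimpleGraph.pathGraph_adj.1 (hadj i)
    rw [Nat.odd_iff]
    omega
  have heven : Even (∑ i, ((s.get i : ℕ) + w i)) := by
    rw [Finset.sum_add_distrib, hsum _ hs.1.injective_get, hsum w hw]
    exact ⟨_, rfl⟩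
  rw [← Nat.not_odd_iff_even, Finset.odd_sum_iff_odd_card_odd,
    Finset.filter_true_of_mem fun i _ => hodd i] at heven
  simpa [hlen] using heven

theorem IsLegalSeq.length_le_pathGraph {n : ℕ} {s : List (Fin n)}
    (hs : IsLegalSeq (SimpleGraph.pathGraph n) s) : s.length ≤ 2 * (n / 2) := by
  have hle : s.length ≤ n := by simpa using hs.1.length_le_card
  rcases hle.lt_or_eq with h | h
  · omega
  · have := Nat.even_iff.1 (hs.even_of_length_eq h)
    omega

/-- The vertices `0, 2, …, 2m - 2` followed by `2m - 1, …, 3, 1` form a legal sequence. -/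
theorem exists_isLegalSeq_pathGraph {n m : ℕ} (hm : 2 * m ≤ n) :
    ∃ s : List (Fin n), IsLegalSeq (SimpleGraph.pathGraph n) s ∧ s.length = 2 * m := by
  let v (k : Fin (2 * m)) : Fin n :=
    ⟨if (k : ℕ) < m then 2 * k else 4 * m - 1 - 2 * k, by split_ifs <;> omega⟩
  let w (k : Fin (2 * m)) : Fin n :=
    ⟨if (k : ℕ) < m then 2 * k + 1 else 4 * m - 2 - 2 * k, by split_ifs <;> omega⟩
  refine ⟨List.ofFn v, ⟨List.nodup_ofFn.2 fun i j hij => ?_, fun i => ?_⟩, by simp⟩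
  · have := congrArg Fin.val hij
    ext
    simp only [v] at this
    split_ifs at this <;> omega
  · have hi : (i : ℕ) < 2 * m := by simpa using i.2
    refine ⟨w ⟨i, hi⟩, ?_, fun j hj => ?_⟩
    · simp only [List.get_ofFn, SimpleGraph.pathGraph_adj, v, w, Fin.val_cast]
      split_ifs <;> omega
    · simp only [List.get_ofFn, SimpleGraph.pathGraph_adj, v, w, Fin.val_cast]
      split_ifs <;> omega

theorem grundyTotal_pathGraph (n : ℕ) (hn : 2 ≤ n) :
    grundyTotal (SimpleGraph.pathGraph n) = 2 * (n / 2) := by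
  refine IsGreatest.csSup_eq ⟨exists_isLegalSeq_pathGraph (Nat.mul_div_le n 2), ?_⟩
  rintro _ ⟨s, hs, rfl⟩
  exact hs.length_le_pathGraph
end
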